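/- arXiv:1311.1994 — 2 statements merged into one kernel-verified Lean document; each statement's English description precedes it below -/
import Mathlib

section
/- Every NIC-planar graph G with at least 3 vertices satisfies e(G) ≤ (18/5)(v(G) − 2), i.e. 5·e(G) ≤ 18·(v(G) − 2), where e(G) and v(G) are the numbers of edges and vertices of G. -/
open Set

/-- Two subsets of the plane *properly cross* at a point `p`: in some open
neighbourhood of `p` the pair of sets looks, up to homeomorphism, like the two
coordinate axes meeting at the origin. -/
def ProperCross (A₁ A₂ : Set (ℝ × ℝ)) (p : ℝ × ℝ) : Prop :=
  ∃ U : Set (ℝ × ℝ), IsOpen U ∧ ∃ hp : p ∈ U, ∃ φ : U ≃ₜ (ℝ × ℝ),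
    φ ⟨p, hp⟩ = (0, 0) ∧
    (fun x => φ x) '' {x : U | (x : ℝ × ℝ) ∈ A₁} = {q : ℝ × ℝ | q.2 = 0} ∧
    (fun x => φ x) '' {x : U | (x : ℝ × ℝ) ∈ A₂} = {q : ℝ × ℝ | q.1 = 0}

/-- A drawing of a simple graph `G` in the plane: vertices go to distinct points,
each edge is drawn as a continuous injective arc joining the points of its two
endpoints, no arc passes through the point of a vertex other than its endpoints,
arcs of edges sharing an endpoint meet only at that common point, any two arcs
meet in finitely many points, every intersection point of two arcs that is not a
common endpoint is a proper crossing, and no point of the plane that is not a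
vertex point lies on more than two arcs. -/
structure Drawing {V : Type*} (G : SimpleGraph V) where
  pos : V → ℝ × ℝ
  pos_inj : Function.Injective pos
  arc : G.edgeSet → ℝ → ℝ × ℝ
  arc_cont : ∀ e, ContinuousOn (arc e) (Icc 0 1)
  arc_inj : ∀ e, InjOn (arc e) (Icc 0 1)
  arc_ends : ∀ e : G.edgeSet, ∃ u v : V, (e : Sym2 V) = s(u, v) ∧
    arc e 0 = pos u ∧ arc e 1 = pos v
  no_vertex_interior : ∀ (e : G.edgeSet) (v : V), v ∉ (e : Sym2 V) →
    pos v ∉ arc e '' Icc 0 1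
  shared_endpoint : ∀ e₁ e₂ : G.edgeSet, e₁ ≠ e₂ → ∀ v : V,
    v ∈ (e₁ : Sym2 V) → v ∈ (e₂ : Sym2 V) →
    arc e₁ '' Icc 0 1 ∩ arc e₂ '' Icc 0 1 ⊆ {pos v}
  finite_meet : ∀ e₁ e₂ : G.edgeSet, e₁ ≠ e₂ →
    (arc e₁ '' Icc 0 1 ∩ arc e₂ '' Icc 0 1).Finite
  proper : ∀ e₁ e₂ : G.edgeSet, e₁ ≠ e₂ →
    ∀ p ∈ arc e₁ '' Icc 0 1 ∩ arc e₂ '' Icc 0 1, p ∉ Set.range pos →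
    ProperCross (arc e₁ '' Icc 0 1) (arc e₂ '' Icc 0 1) p
  at_most_two : ∀ p : ℝ × ℝ, p ∉ Set.range pos →
    ∀ e₁ e₂ e₃ : G.edgeSet, p ∈ arc e₁ '' Icc 0 1 → p ∈ arc e₂ '' Icc 0 1 →
      p ∈ arc e₃ '' Icc 0 1 → e₁ = e₂ ∨ e₁ = e₃ ∨ e₂ = e₃

namespace Drawing

variable {V : Type*} {G : SimpleGraph V}

/-- The image of the arc drawn for the edge `e`. -/
def arcIm (D : Drawing G) (e : G.edgeSet) : Set (ℝ × ℝ) :=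
  D.arc e '' Icc 0 1

/-- The set of crossings of the drawing: points that are not vertex points and
lie on (at least, hence exactly) two arcs.  (An intersection point of two arcs
that is a common endpoint of the two edges is a vertex point, and conversely a
vertex point on two arcs is a common endpoint, so these are precisely the
intersection points of pairs of arcs that are not common endpoints.) -/
def crossings (D : Drawing G) : Set (ℝ × ℝ) :=
  {p | p ∉ Set.range D.pos ∧ ∃ e₁ e₂ : G.edgeSet, e₁ ≠ e₂ ∧ p ∈ D.arcIm e₁ ∧ p ∈ D.arcIm e₂}

/-- The number of crossings of the drawing. -/
noncomputable def crossingCount (D : Drawing G) : ℕ := D.crossings.ncard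

/-- The cluster set `S(c)` of a crossing `c`: the set of end-vertices of the
(two) edges whose arcs pass through `c`. -/
def cluster (D : Drawing G) (c : ℝ × ℝ) : Set V :=
  {v | ∃ e : G.edgeSet, c ∈ D.arcIm e ∧ v ∈ (e : Sym2 V)}

/-- A drawing is 1-planar if each edge's arc is crossed at most once. -/
def IsOnePlanar (D : Drawing G) : Prop :=
  ∀ e : G.edgeSet, {p | p ∈ D.crossings ∧ p ∈ D.arcIm e}.Subsingleton

/-- A drawing is NIC-planar if it is 1-planar and the cluster sets of any two
distinct crossings share at most one vertex. -/
def IsNICPlanar (D : Drawing G) : Prop :=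
  D.IsOnePlanar ∧ ∀ c₁ ∈ D.crossings, ∀ c₂ ∈ D.crossings, c₁ ≠ c₂ →
    (D.cluster c₁ ∩ D.cluster c₂).ncard ≤ 1

/-- A drawing is IC-planar if it is 1-planar and the cluster sets of any two
distinct crossings are disjoint. -/
def IsICPlanar (D : Drawing G) : Prop :=
  D.IsOnePlanar ∧ ∀ c₁ ∈ D.crossings, ∀ c₂ ∈ D.crossings, c₁ ≠ c₂ →
    D.cluster c₁ ∩ D.cluster c₂ = ∅

end Drawing

/-- A graph is 1-planar if it admits a 1-planar drawing. -/
def SimpleGraph.OnePlanar {V : Type*} (G : SimpleGraph V) : Prop :=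
  ∃ D : Drawing G, D.IsOnePlanar

/-- A graph is NIC-planar if it admits an NIC-planar drawing. -/
def SimpleGraph.NICPlanar {V : Type*} (G : SimpleGraph V) : Prop :=
  ∃ D : Drawing G, D.IsNICPlanar

/-- A graph is IC-planar if it admits an IC-planar drawing. -/
def SimpleGraph.ICPlanar {V : Type*} (G : SimpleGraph V) : Prop :=
  ∃ D : Drawing G, D.IsICPlanar

/-- The crossing number of `G`: the minimum number of crossings over all
drawings of `G`. -/
noncomputable def SimpleGraph.crossingNumber {V : Type*} (G : SimpleGraph V) : ℕ :=
  sInf {n | ∃ D : Drawing G, D.crossingCount = n}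
/-- The graph `H` is a minimum non-NIC-planar graph: `H` is not NIC-planar but
deleting any single edge of `H` yields an NIC-planar graph. -/
def MinNonNICPlanar {V : Type*} (H : SimpleGraph V) : Prop :=
  ¬ H.NICPlanar ∧ ∀ e ∈ H.edgeSet, (H.deleteEdges {e}).NICPlanar

/-- The graph `H` is a minimum non-IC-planar graph: `H` is not IC-planar but
deleting any single edge of `H` yields an IC-planar graph. -/
def MinNonICPlanar {V : Type*} (H : SimpleGraph V) : Prop :=
  ¬ H.ICPlanar ∧ ∀ e ∈ H.edgeSet, (H.deleteEdges {e}).ICPlanar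

/-- The complete multipartite graph with parts of sizes `a 0, …, a (k-1)`. -/
abbrev completeMultipartite {k : ℕ} (a : Fin k → ℕ) :
    SimpleGraph (Σ i : Fin k, Fin (a i)) :=
  SimpleGraph.completeMultipartiteGraph fun i => Fin (a i)

/-- `G` contains a subgraph isomorphic to `H`, i.e. there is an injective graph
homomorphism from `H` to `G`. -/
def ContainsSubgraphIso {V W : Type*} (G : SimpleGraph V) (H : SimpleGraph W) : Prop :=
  ∃ f : H →g G, Function.Injective f

open Filter Topology in
/-- A continuous logarithm of a differentiable function is differentiable. -/
theorem hasDerivAt_of_exp_eventuallyEq {L h : ℂ → ℂ} {h' z₀ : ℂ} (hL : ContinuousAt L z₀)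
    (he : ∀ᶠ z in 𝓝 z₀, Complex.exp (L z) = h z) (hh : HasDerivAt h h' z₀) :
    HasDerivAt L (h' / h z₀) z₀ := by
  have h0 : Complex.exp (L z₀) = h z₀ := he.self_of_nhds
  have hne : h z₀ ≠ 0 := h0 ▸ Complex.exp_ne_zero _
  have hev : ∀ᶠ z in 𝓝 z₀, L z = L z₀ + Complex.log (h z / h z₀) := by
    have hsmall : ∀ᶠ z in 𝓝 z₀, ‖L z - L z₀‖ < Real.pi := by
      have : Tendsto (fun z => ‖L z - L z₀‖) (𝓝 z₀) (𝓝 0) := by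
        have := (hL.tendsto.sub_const (L z₀)).norm
        simpa using this
      exact this.eventually (gt_mem_nhds Real.pi_pos)
    filter_upwards [he, hsmall] with z hz hs
    have him := (Complex.abs_im_le_norm (L z - L z₀)).trans_lt hs
    rw [abs_lt] at him
    rw [← hz, ← h0, ← Complex.exp_sub, Complex.log_exp him.1 him.2.le]
    ring
  have hd : HasDerivAt (fun z => L z₀ + Complex.log (h z / h z₀)) (h' / h z₀) z₀ := by
    have h1 : HasDerivAt (fun z => h z / h z₀) (h' / h z₀) z₀ := hh.div_const _
    have h2 : h z₀ / h z₀ ∈ Complex.slitPlane := by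
      rw [div_self hne]; exact Complex.one_mem_slitPlane
    have := (h1.clog h2).const_add (L z₀)
    simpa [div_self hne] using this
  exact hd.congr_of_eventuallyEq hev

/-- On the complement of a path from `p` to `q`, the function `(z - p) / (z - q)` has a
continuous logarithm. -/
theorem exists_log_compl_path {γ : ℝ → ℂ} (hγ : ContinuousOn γ (Icc 0 1)) :
    ∃ L : ℂ → ℂ, ContinuousOn L (γ '' Icc 0 1)ᶜ ∧
      ∀ z ∉ γ '' Icc 0 1, Complex.exp (L z) = (z - γ 0) / (z - γ 1) := by
  let U : Set ℂ := (γ '' Icc 0 1)ᶜ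
  have hne : ∀ (t : unitInterval) (z : U), (z : ℂ) - γ t ≠ 0 := fun t z h =>
    z.2 ⟨t, t.2, (sub_eq_zero.1 h).symm⟩
  have hγ' : Continuous fun t : unitInterval => γ t := hγ.domRestrict
  let H : C(unitInterval × U, {z : ℂ // z ≠ 0}) :=
    ⟨fun x => ⟨(x.2 - γ 0) / (x.2 - γ x.1), div_ne_zero (hne 0 x.2) (hne x.1 x.2)⟩, by
      have hd : Continuous fun x : unitInterval × U => (x.2 : ℂ) - γ x.1 :=
        (continuous_subtype_val.comp continuous_snd).sub (hγ'.comp continuous_fst)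
      have hn : Continuous fun x : unitInterval × U => (x.2 : ℂ) - γ 0 := by fun_prop
      exact (hn.div hd fun x => hne x.1 x.2).subtype_mk _⟩
  let f : C(U, ℂ) := ContinuousMap.const _ 0
  have H0 : ∀ a : U, H (0, a) = (⟨_, (f a).exp_ne_zero⟩ : {z : ℂ // z ≠ 0}) := by
    intro a
    ext
    simp only [H, f, ContinuousMap.coe_mk, ContinuousMap.const_apply, Complex.exp_zero]
    exact div_self (hne 0 a)
  let G := Complex.isCoveringMap_exp.liftHomotopy H f H0
  have hG : ∀ x, Complex.exp (G x) = (H x : ℂ) := fun x =>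
    congrArg Subtype.val (congrFun (Complex.isCoveringMap_exp.liftHomotopy_lifts H f H0) x)
  classical
  refine ⟨fun z => if hz : z ∈ U then G (1, ⟨z, hz⟩) else 0, ?_, fun z hz => ?_⟩
  · rw [continuousOn_iff_continuous_domRestrict]
    have : Continuous fun z : U => G (1, z) := by fun_prop
    refine this.congr fun z => ?_
    simp [Set.domRestrict, z.2]
  · have hz' : z ∈ U := hz
    simp only [hz', dif_pos, hG, H, ContinuousMap.coe_mk]
    simp

/-- A nonvanishing continuous function along an interval has a continuous logarithm. -/
theorem exists_log_Icc {h : ℝ → ℂ} (hh : ContinuousOn h (Icc 0 1))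
    (h0 : ∀ t ∈ Icc (0:ℝ) 1, h t ≠ 0) :
    ∃ l : ℝ → ℂ, ContinuousOn l (Icc 0 1) ∧ ∀ t ∈ Icc (0:ℝ) 1, Complex.exp (l t) = h t := by
  have hc : Continuous (IccExtend zero_le_one (domRestrict (Icc (0:ℝ) 1) h)) :=
    hh.domRestrict.Icc_extend'
  have hs : IsSimplyConnected (univ : Set ℝ) :=
    have := (convex_univ (𝕜 := ℝ) (E := ℝ)).contractibleSpace univ_nonempty
    (inferInstance : SimplyConnectedSpace (univ : Set ℝ))
  obtain ⟨l, hl, hl'⟩ := Complex.exists_continuousOn_eqOn_exp_comp hs isOpen_univ hc.continuousOn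
    (by rintro ⟨t, -, ht⟩; exact h0 _ (projIcc 0 1 zero_le_one t).2 ht)
  refine ⟨l, hl.mono (subset_univ _), fun t ht => ?_⟩
  have := hl' (mem_univ t)
  simpa [IccExtend_of_mem _ _ ht] using this

/-- A nonvanishing continuous function on the plane has a continuous logarithm. -/
theorem exists_log_complex {h : ℂ → ℂ} (hh : Continuous h) (h0 : ∀ z, h z ≠ 0) :
    ∃ l : ℂ → ℂ, Continuous l ∧ ∀ z, Complex.exp (l z) = h z := by
  have hs : IsSimplyConnected (univ : Set ℂ) :=
    have := (convex_univ (𝕜 := ℝ) (E := ℂ)).contractibleSpace univ_nonempty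
    (inferInstance : SimplyConnectedSpace (univ : Set ℂ))
  obtain ⟨l, hl, hl'⟩ := Complex.exists_continuousOn_eqOn_exp_comp hs isOpen_univ hh.continuousOn
    (by rintro ⟨t, -, ht⟩; exact h0 _ ht)
  exact ⟨l, continuousOn_univ.1 hl, fun z => hl' (mem_univ z)⟩

theorem isPreconnected_norm_gt (R : ℝ) (hR : 0 < R) : IsPreconnected {z : ℂ | R < ‖z‖} := by
  have h : {z : ℂ | R < ‖z‖} = Complex.exp '' {z : ℂ | Real.log R < z.re} := by
    ext z
    constructor
    · intro (hz : R < ‖z‖)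
      have hz0 : z ≠ 0 := norm_pos_iff.1 (hR.trans hz)
      exact ⟨Complex.log z, by simpa [Complex.log_re] using Real.log_lt_log hR hz,
        Complex.exp_log hz0⟩
    · rintro ⟨w, hw, rfl⟩
      have : Real.log R < w.re := hw
      simpa [Complex.norm_exp] using (Real.log_lt_iff_lt_exp hR).1 this
  rw [h]
  exact (convex_halfSpace_re_gt _).isPreconnected.image _ Complex.continuous_exp.continuousOn

/-- The frontier of a component of the complement of a closed set lies in that set. -/
theorem frontier_connectedComponentIn_subset {K : Set ℂ} (hK : IsClosed K) (x : ℂ) :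
    frontier (connectedComponentIn Kᶜ x) ⊆ K := by
  intro z hz
  by_contra hzK
  have ho : IsOpen (connectedComponentIn Kᶜ x) := hK.isOpen_compl.connectedComponentIn
  have hz' : z ∈ connectedComponentIn Kᶜ z := mem_connectedComponentIn hzK
  obtain ⟨w, hwz, hwx⟩ := mem_closure_iff.1 hz.1 _ hK.isOpen_compl.connectedComponentIn hz'
  rw [connectedComponentIn_eq hwx, ← connectedComponentIn_eq hwz] at hz
  exact hz.2 (hK.isOpen_compl.connectedComponentIn.interior_eq.symm ▸ hz')

/-- Two distinct components of the complement of a compact plane set are not both unbounded. -/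
theorem connectedComponentIn_bounded_or {K : Set ℂ} (hK : IsCompact K) {x y : ℂ}
    (hxy : connectedComponentIn Kᶜ x ≠ connectedComponentIn Kᶜ y) :
    Bornology.IsBounded (connectedComponentIn Kᶜ x) ∨
      Bornology.IsBounded (connectedComponentIn Kᶜ y) := by
  obtain ⟨R, hR0, hR⟩ := hK.isBounded.exists_pos_norm_le
  have hsub : {z : ℂ | R < ‖z‖} ⊆ Kᶜ := fun z hz hzK => not_lt.2 (hR z hzK) hz
  by_contra! hcon
  have key : ∀ x, ¬ Bornology.IsBounded (connectedComponentIn Kᶜ x) →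
      ∃ w ∈ connectedComponentIn Kᶜ x, R < ‖w‖ := by
    intro x hx
    by_contra! h
    exact hx (isBounded_iff_forall_norm_le.2 ⟨R, h⟩)
  obtain ⟨w, hw, hwR⟩ := key x hcon.1
  obtain ⟨v, hv, hvR⟩ := key y hcon.2
  have := (isPreconnected_norm_gt R hR0).subset_connectedComponentIn hwR hsub hvR
  rw [← connectedComponentIn_eq hw] at this
  exact hxy ((connectedComponentIn_eq this).trans (connectedComponentIn_eq hv).symm)

/-- Borsuk's criterion: a product of powers `(z - x i) ^ a i`, with the `x i` in distinct
components of the complement of `K`, has no continuous logarithm on `K` if one of the exponents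
with a bounded component is nonzero. -/
theorem exponent_eq_zero_of_bounded {ι : Type*} [Fintype ι] {K : Set ℂ} (hK : IsCompact K)
    {x : ι → ℂ} (hx : ∀ i, x i ∉ K)
    (hinj : Function.Injective fun i => connectedComponentIn Kᶜ (x i)) {a : ι → ℤ}
    {G : ℂ → ℂ} (hG : ContinuousOn G K) (he : ∀ z ∈ K, Complex.exp (G z) = ∏ i, (z - x i) ^ a i)
    (i : ι) (hb : Bornology.IsBounded (connectedComponentIn Kᶜ (x i))) : a i = 0 := by
  classical
  set U := connectedComponentIn Kᶜ (x i) with hU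
  have hUo : IsOpen U := hK.isClosed.isOpen_compl.connectedComponentIn
  have hxU : x i ∈ U := mem_connectedComponentIn (hx i)
  have hclU : closure U ⊆ U ∪ K := by
    intro z hz
    by_cases h : z ∈ U
    · exact .inl h
    · exact .inr (frontier_connectedComponentIn_subset hK.isClosed (x i)
        ⟨hz, by rwa [hUo.interior_eq]⟩)
  have hjU : ∀ j ≠ i, x j ∉ closure U := by
    intro j hj hjU
    rcases hclU hjU with h | h
    · exact hj (hinj (connectedComponentIn_eq h).symm)
    · exact hx j h
  obtain ⟨g, hg⟩ := ContinuousMap.exists_restrict_eq hK.isClosed ⟨K.domRestrict G, hG.domRestrict⟩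
  have hgG : ∀ z ∈ K, g z = G z := fun z hz => DFunLike.congr_fun hg (⟨z, hz⟩ : K)
  let A : ℂ → ℂ := fun z => Complex.exp (g z) * ∏ j ∈ Finset.univ.erase i, (z - x j) ^ (-a j)
  let B : ℂ → ℂ := fun z => (z - x i) ^ a i
  have hAB : ∀ z ∈ frontier U, A z = B z := by
    intro z hz
    have hzK := frontier_connectedComponentIn_subset hK.isClosed (x i) hz
    have hne : ∀ j, z - x j ≠ 0 := fun j h => hx j (sub_eq_zero.1 h ▸ hzK)
    simp only [A, B]
    rw [hgG z hzK, he z hzK, ← Finset.mul_prod_erase _ _ (Finset.mem_univ i), mul_assoc,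
      ← Finset.prod_mul_distrib, Finset.prod_eq_one, mul_one]
    intro j _
    rw [← zpow_add₀ (hne j)]; simp
  let H : ℂ → ℂ := U.piecewise A B
  have hHc : Continuous H := by
    refine continuous_piecewise hAB ?_ ?_
    · refine ContinuousOn.mul (by fun_prop) (continuousOn_finsetProd _ fun j hj => ?_)
      refine ContinuousOn.zpow₀ (by fun_prop) _ fun z hz => .inl fun h => ?_
      exact hjU j (Finset.ne_of_mem_erase hj) (sub_eq_zero.1 h ▸ hz)
    · refine ContinuousOn.zpow₀ (by fun_prop) _ fun z hz => .inl fun h => ?_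
      rw [closure_compl, hUo.interior_eq] at hz
      exact hz (sub_eq_zero.1 h ▸ hxU)
  have hH0 : ∀ z, H z ≠ 0 := by
    intro z
    by_cases hz : z ∈ U
    · simp only [H, piecewise_eq_of_mem _ _ _ hz, A]
      refine mul_ne_zero (Complex.exp_ne_zero _) (Finset.prod_ne_zero_iff.2 fun j hj => ?_)
      refine zpow_ne_zero _ fun h => ?_
      exact hjU j (Finset.ne_of_mem_erase hj) (sub_eq_zero.1 h ▸ subset_closure hz)
    · simp only [H, piecewise_eq_of_notMem _ _ _ hz, B]
      exact zpow_ne_zero _ fun h => hz (sub_eq_zero.1 h ▸ hxU)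
  obtain ⟨l, hl, hle⟩ := exists_log_complex hHc hH0
  obtain ⟨R, hR0, hR⟩ := hb.subset_closedBall_lt 0 (x i)
  have hd : ∀ z ∈ Metric.sphere (x i) (R + 1), HasDerivAt l (a i * (z - x i)⁻¹) z := by
    intro z hz
    have hzx : z - x i ≠ 0 := by
      intro h
      rw [sub_eq_zero.1 h] at hz
      simp at hz
      linarith
    have hev : ∀ᶠ w in nhds z, Complex.exp (l w) = B w := by
      have : (Metric.closedBall (x i) R)ᶜ ∈ nhds z := by
        refine Metric.isClosed_closedBall.isOpen_compl.mem_nhds fun h => ?_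
        rw [Metric.mem_sphere] at hz
        rw [Metric.mem_closedBall, hz] at h
        linarith
      filter_upwards [this] with w hw
      rw [hle]
      exact piecewise_eq_of_notMem _ _ _ fun h => hw (hR h)
    have hB : HasDerivAt B (a i * (z - x i) ^ (a i - 1) * 1) z :=
      HasDerivAt.comp (h₂ := fun w : ℂ => w ^ a i) z (hasDerivAt_zpow (a i) (z - x i) (.inl hzx))
        ((hasDerivAt_id z).sub_const _)
    convert hasDerivAt_of_exp_eventuallyEq hl.continuousAt hev hB using 1
    simp only [B, mul_one]
    rw [zpow_sub_one₀ hzx]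
    field_simp
  have h1 := circleIntegral.integral_eq_zero_of_hasDerivWithinAt (by linarith : (0:ℝ) ≤ R + 1)
    fun z hz => (hd z hz).hasDerivWithinAt
  rw [circleIntegral.integral_const_mul, circleIntegral.integral_sub_center_inv _ (by linarith)] at h1
  simpa [Real.pi_ne_zero] using h1

/-- Borsuk's criterion for functions of degree zero. -/
theorem exponent_eq_zero {ι : Type*} [Fintype ι] {K : Set ℂ} (hK : IsCompact K)
    {x : ι → ℂ} (hx : ∀ i, x i ∉ K)
    (hinj : Function.Injective fun i => connectedComponentIn Kᶜ (x i)) {a : ι → ℤ}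
    (hsum : ∑ i, a i = 0)
    {G : ℂ → ℂ} (hG : ContinuousOn G K) (he : ∀ z ∈ K, Complex.exp (G z) = ∏ i, (z - x i) ^ a i)
    (i : ι) : a i = 0 := by
  by_cases hb : Bornology.IsBounded (connectedComponentIn Kᶜ (x i))
  · exact exponent_eq_zero_of_bounded hK hx hinj hG he i hb
  · rw [← hsum, eq_comm]
    refine Fintype.sum_eq_single i fun j hj => ?_
    refine exponent_eq_zero_of_bounded hK hx hinj hG he j ?_
    exact (connectedComponentIn_bounded_or hK (hinj.ne hj)).resolve_right hb

/-- A finite multigraph drawn in the complex plane without crossings. -/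
structure PlaneGraph (N E : Type*) where
  pos : N → ℂ
  src : E → N
  tgt : E → N
  arc : E → ℝ → ℂ
  pos_inj : Function.Injective pos
  arc_cont : ∀ e, ContinuousOn (arc e) (Icc 0 1)
  arc_inj : ∀ e, InjOn (arc e) (Icc 0 1)
  arc_zero : ∀ e, arc e 0 = pos (src e)
  arc_one : ∀ e, arc e 1 = pos (tgt e)
  arc_ne_pos : ∀ e, ∀ t ∈ Ioo (0 : ℝ) 1, ∀ v, arc e t ≠ pos v
  arc_ne_arc : ∀ e e', e ≠ e' → ∀ t ∈ Ioo (0 : ℝ) 1, ∀ t' ∈ Ioo (0 : ℝ) 1, arc e t ≠ arc e' t'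

theorem eq_zero_or_mem_Ioo_or_eq_one {t : ℝ} (ht : t ∈ Icc (0 : ℝ) 1) :
    t = 0 ∨ t ∈ Ioo (0 : ℝ) 1 ∨ t = 1 := by
  rcases ht.1.eq_or_lt with h | h
  · exact .inl h.symm
  rcases ht.2.eq_or_lt with h' | h'
  · exact .inr (.inr h')
  · exact .inr (.inl ⟨h, h'⟩)

theorem continuousOn_image_Icc {γ : ℝ → ℂ} (hγ : ContinuousOn γ (Icc 0 1)) {G : ℂ → ℂ}
    (hG : ContinuousOn (fun t => G (γ t)) (Icc 0 1)) : ContinuousOn G (γ '' Icc 0 1) := by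
  let q : Icc (0 : ℝ) 1 → γ '' Icc 0 1 := (mapsTo_image γ (Icc 0 1)).restrict
  have hq : Continuous q := hγ.mapsToRestrict _
  have hs : Function.Surjective q := by
    rintro ⟨_, t, ht, rfl⟩
    exact ⟨⟨t, ht⟩, rfl⟩
  rw [continuousOn_iff_continuous_domRestrict,
    (hq.isClosedMap.isQuotientMap hq hs).continuous_iff]
  exact hG.domRestrict

namespace PlaneGraph

variable {N E : Type*} (Γ : PlaneGraph N E)

/-- The subset of the plane covered by the vertices and the edges in `S`. -/
def carrier (S : Set E) : Set ℂ := range Γ.pos ∪ ⋃ e ∈ S, Γ.arc e '' Icc 0 1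

variable {Γ}

theorem pos_mem_carrier (S : Set E) (v : N) : Γ.pos v ∈ Γ.carrier S := .inl ⟨v, rfl⟩

theorem arc_mem_carrier {S : Set E} {e : E} (he : e ∈ S) {t : ℝ} (ht : t ∈ Icc (0 : ℝ) 1) :
    Γ.arc e t ∈ Γ.carrier S := .inr (mem_biUnion he ⟨t, ht, rfl⟩)

theorem carrier_mono {S T : Set E} (h : S ⊆ T) : Γ.carrier S ⊆ Γ.carrier T :=
  union_subset_union_right _ (biUnion_subset_biUnion_left h)

theorem arc_notMem_carrier {S : Set E} {e : E} (he : e ∉ S) {t : ℝ} (ht : t ∈ Ioo (0 : ℝ) 1) :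
    Γ.arc e t ∉ Γ.carrier S := by
  rintro (⟨v, hv⟩ | h)
  · exact Γ.arc_ne_pos e t ht v hv.symm
  · simp only [mem_iUnion] at h
    obtain ⟨e', he', t', ht', h⟩ := h
    rcases eq_zero_or_mem_Ioo_or_eq_one ht' with rfl | h' | rfl
    · exact Γ.arc_ne_pos e t ht _ (h.symm.trans (Γ.arc_zero e'))
    · exact Γ.arc_ne_arc e' e (fun hh => he (hh ▸ he')) t' h' t ht h
    · exact Γ.arc_ne_pos e t ht _ (h.symm.trans (Γ.arc_one e'))

theorem isCompact_carrier [Finite N] [Finite E] (S : Set E) : IsCompact (Γ.carrier S) :=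
  (finite_range _).isCompact.union
    (S.toFinite.isCompact_biUnion fun e _ => isCompact_Icc.image_of_continuousOn (Γ.arc_cont e))

theorem src_ne_tgt (e : E) : Γ.src e ≠ Γ.tgt e := by
  intro h
  have : Γ.arc e 0 = Γ.arc e 1 := by rw [Γ.arc_zero, Γ.arc_one, h]
  exact zero_ne_one (Γ.arc_inj e (by simp) (by simp) this)

/-- A function on the arcs and vertices that agrees at the end points comes from the plane. -/
theorem exists_glue (S : Set E) (f : E → ℝ → ℂ) (lam : N → ℂ)
    (h0 : ∀ e ∈ S, f e 0 = lam (Γ.src e)) (h1 : ∀ e ∈ S, f e 1 = lam (Γ.tgt e)) :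
    ∃ g : ℂ → ℂ, (∀ v, g (Γ.pos v) = lam v) ∧
      ∀ e ∈ S, ∀ t ∈ Icc (0 : ℝ) 1, g (Γ.arc e t) = f e t := by
  have key : ∀ z : ℂ, ∃ w : ℂ, (∀ v, z = Γ.pos v → w = lam v) ∧
      ∀ e ∈ S, ∀ t ∈ Icc (0 : ℝ) 1, z = Γ.arc e t → w = f e t := by
    intro z
    by_cases hv : ∃ v, z = Γ.pos v
    · obtain ⟨v, rfl⟩ := hv
      refine ⟨lam v, fun u hu => by rw [Γ.pos_inj hu], fun e he t ht h => ?_⟩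
      rcases eq_zero_or_mem_Ioo_or_eq_one ht with rfl | h' | rfl
      · rw [h0 e he, Γ.pos_inj (h.trans (Γ.arc_zero e))]
      · exact absurd h.symm (Γ.arc_ne_pos e t h' v)
      · rw [h1 e he, Γ.pos_inj (h.trans (Γ.arc_one e))]
    · by_cases he : ∃ e ∈ S, ∃ t ∈ Icc (0 : ℝ) 1, z = Γ.arc e t
      · obtain ⟨e, he, t, ht, rfl⟩ := he
        have hIoo : ∀ e t, t ∈ Icc (0 : ℝ) 1 → (∀ v, Γ.arc e t ≠ Γ.pos v) → t ∈ Ioo (0 : ℝ) 1 := by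
          intro e t ht hn
          rcases eq_zero_or_mem_Ioo_or_eq_one ht with rfl | h' | rfl
          · exact absurd (Γ.arc_zero e) (hn _)
          · exact h'
          · exact absurd (Γ.arc_one e) (hn _)
        push Not at hv
        refine ⟨f e t, fun v h => absurd h (hv v), fun e' he' t' ht' h => ?_⟩
        by_cases hee : e = e'
        · subst hee
          rw [Γ.arc_inj e ht ht' h]
        · exact absurd h (Γ.arc_ne_arc e e' hee t (hIoo e t ht hv) t'
            (hIoo e' t' ht' (h ▸ hv)))
      · push Not at hv he
        exact ⟨0, fun v h => absurd h (hv v), fun e h t ht h' => absurd h' (he e h t ht)⟩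
  choose g hg using key
  exact ⟨g, fun v => (hg _).1 v rfl, fun e he t ht => (hg _).2 e he t ht rfl⟩

/-- Logarithms along the arcs whose increments form a coboundary glue to a logarithm on the
carrier. -/
theorem exists_log_carrier [Finite N] [Finite E] {S : Set E} {h : ℂ → ℂ}
    (h0 : ∀ z ∈ Γ.carrier S, h z ≠ 0) {l : E → ℝ → ℂ}
    (hl : ∀ e ∈ S, ContinuousOn (l e) (Icc 0 1))
    (hle : ∀ e ∈ S, ∀ t ∈ Icc (0 : ℝ) 1, Complex.exp (l e t) = h (Γ.arc e t)) {lam : N → ℂ}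
    (hlam : ∀ e ∈ S, lam (Γ.tgt e) - lam (Γ.src e) = l e 1 - l e 0) :
    ∃ G : ℂ → ℂ, ContinuousOn G (Γ.carrier S) ∧ ∀ z ∈ Γ.carrier S, Complex.exp (G z) = h z := by
  obtain ⟨g, -, hg⟩ := Γ.exists_glue S (fun e t => l e t - l e 0 + lam (Γ.src e)) lam
    (by simp) (fun e he => by rw [← hlam e he]; ring)
  refine ⟨fun z => g z + Complex.log (h z * Complex.exp (-g z)), ?_, fun z hz => ?_⟩
  · refine ContinuousOn.union_of_isClosed ((finite_range _).continuousOn _) ?_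
      (finite_range _).isClosed (S.toFinite.isCompact_biUnion fun e _ =>
        isCompact_Icc.image_of_continuousOn (Γ.arc_cont e)).isClosed
    rw [biUnion_eq_iUnion]
    refine (locallyFinite_of_finite _).continuousOn_iUnion
      (fun e => (isCompact_Icc.image_of_continuousOn (Γ.arc_cont e)).isClosed) fun e => ?_
    refine continuousOn_image_Icc (Γ.arc_cont e) ?_
    refine ContinuousOn.congr (f := fun t => l e t - l e 0 + lam (Γ.src e) +
      Complex.log (Complex.exp (l e 0 - lam (Γ.src e)))) ?_ fun t ht => ?_
    · exact (((hl e e.2).sub continuousOn_const).add continuousOn_const).add continuousOn_const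
    · simp only [hg e e.2 t ht]
      rw [← hle e e.2 t ht, ← Complex.exp_add]
      ring_nf
  · rw [Complex.exp_add, Complex.exp_log (mul_ne_zero (h0 z hz) (Complex.exp_ne_zero _)),
      mul_left_comm, ← Complex.exp_add]
    simp

variable (Γ) in
/-- The edge `e` lies on the boundary of the face containing `x`. -/
def Touches (x : ℂ) (e : E) : Prop :=
  ∃ t ∈ Ioo (0 : ℝ) 1, Γ.arc e t ∈ closure (connectedComponentIn (Γ.carrier univ)ᶜ x)

/-- For points in one component of the complement of `K`, `(z - x) / (z - y)` has a logarithm. -/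
theorem _root_.exists_log_of_mem_connectedComponentIn {K : Set ℂ} (hK : IsClosed K) {m x y : ℂ}
    (hx : x ∈ connectedComponentIn Kᶜ m) (hy : y ∈ connectedComponentIn Kᶜ m) :
    ∃ L : ℂ → ℂ, ContinuousOn L K ∧ ∀ z ∈ K, Complex.exp (L z) = (z - x) / (z - y) := by
  have hpc : IsPathConnected (connectedComponentIn Kᶜ m) :=
    hK.isOpen_compl.connectedComponentIn.isConnected_iff_isPathConnected.1
      ⟨⟨x, hx⟩, isPreconnected_connectedComponentIn⟩
  obtain ⟨p, hp⟩ := hpc.joinedIn x hx y hy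
  have hsub : K ⊆ (p.extend '' Icc 0 1)ᶜ := by
    rintro z hz ⟨t, ht, rfl⟩
    rw [p.extend_apply ht] at hz
    exact connectedComponentIn_subset _ _ (hp ⟨t, ht⟩) hz
  obtain ⟨L, hL, hLe⟩ := exists_log_compl_path (γ := p.extend) p.continuous_extend.continuousOn
  refine ⟨L, hL.mono hsub, fun z hz => ?_⟩
  rw [hLe z (hsub hz)]
  simp

theorem mem_component_of_touches {x : ℂ} (hx : x ∉ Γ.carrier univ) {e : E}
    (h : Γ.Touches x e) :
    x ∈ connectedComponentIn (Γ.carrier {e}ᶜ)ᶜ (Γ.arc e (1 / 2)) := by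
  obtain ⟨t, ht, htx⟩ := h
  have harc : Γ.arc e '' Ioo 0 1 ⊆ (Γ.carrier {e}ᶜ)ᶜ := by
    rintro _ ⟨s, hs, rfl⟩
    exact Γ.arc_notMem_carrier (by simp) hs
  have hpre : IsPreconnected (Γ.arc e '' Ioo 0 1) :=
    isPreconnected_Ioo.image _ ((Γ.arc_cont e).mono Ioo_subset_Icc_self)
  have h1 : Γ.arc e t ∈ connectedComponentIn (Γ.carrier {e}ᶜ)ᶜ (Γ.arc e (1 / 2)) :=
    hpre.subset_connectedComponentIn ⟨1 / 2, by norm_num, rfl⟩ harc ⟨t, ht, rfl⟩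
  have hC : IsPreconnected (insert (Γ.arc e t) (connectedComponentIn (Γ.carrier univ)ᶜ x)) :=
    isPreconnected_connectedComponentIn.subset_closure (subset_insert _ _)
      (insert_subset htx subset_closure)
  rw [connectedComponentIn_eq h1]
  refine hC.subset_connectedComponentIn (mem_insert _ _) (insert_subset ?_ ?_)
    (mem_insert_of_mem _ (mem_connectedComponentIn hx))
  · exact harc ⟨t, ht, rfl⟩
  · exact (connectedComponentIn_subset _ _).trans
      (compl_subset_compl.2 (carrier_mono (subset_univ _)))

/-- An edge lies on the boundary of at most two faces. -/
theorem not_touches_three [Finite N] [Finite E] (e : E) {x : Fin 3 → ℂ}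
    (hx : ∀ i, x i ∉ Γ.carrier univ)
    (hinj : Function.Injective fun i => connectedComponentIn (Γ.carrier univ)ᶜ (x i))
    (ht : ∀ i, Γ.Touches (x i) e) : False := by
  classical
  have hlog : ∀ i, ∃ (l : E → ℝ → ℂ) (lam : N → ℂ) (n : ℤ),
      (∀ e, ContinuousOn (l e) (Icc 0 1)) ∧
      (∀ e, ∀ t ∈ Icc (0 : ℝ) 1,
        Complex.exp (l e t) = (Γ.arc e t - x i) / (Γ.arc e t - x 0)) ∧
      (∀ e' ≠ e, lam (Γ.tgt e') - lam (Γ.src e') = l e' 1 - l e' 0) ∧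
      lam (Γ.tgt e) - lam (Γ.src e) = l e 1 - l e 0 + n * (2 * Real.pi * Complex.I) := by
    intro i
    obtain ⟨L, hL, hLe⟩ := exists_log_of_mem_connectedComponentIn
      (Γ.isCompact_carrier {e}ᶜ).isClosed (Γ.mem_component_of_touches (hx i) (ht i))
      (Γ.mem_component_of_touches (hx 0) (ht 0))
    have hne : ∀ j, ∀ t ∈ Icc (0 : ℝ) 1, Γ.arc e t - x j ≠ 0 := fun j t ht h =>
      hx j (sub_eq_zero.1 h ▸ Γ.arc_mem_carrier (mem_univ e) ht)
    obtain ⟨k, hk, hke⟩ := exists_log_Icc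
      (h := fun t => (Γ.arc e t - x i) / (Γ.arc e t - x 0))
      (((Γ.arc_cont e).sub continuousOn_const).div ((Γ.arc_cont e).sub continuousOn_const)
        (hne 0)) fun t ht => div_ne_zero (hne i t ht) (hne 0 t ht)
    have hends : Complex.exp (L (Γ.pos (Γ.tgt e)) - L (Γ.pos (Γ.src e))) =
        Complex.exp (k 1 - k 0) := by
      rw [Complex.exp_sub, Complex.exp_sub, hLe _ (Γ.pos_mem_carrier _ _),
        hLe _ (Γ.pos_mem_carrier _ _), hke 0 (by simp), hke 1 (by simp), Γ.arc_zero, Γ.arc_one]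
    obtain ⟨n, hn⟩ := Complex.exp_eq_exp_iff_exists_int.1 hends
    refine ⟨fun e' => if e' = e then k else fun t => L (Γ.arc e' t), fun v => L (Γ.pos v), n,
      fun e' => ?_, fun e' t ht => ?_, fun e' he' => ?_, ?_⟩
    · by_cases he' : e' = e
      · simpa [he'] using hk
      · simp only [he', if_false]
        exact hL.comp (Γ.arc_cont e') fun t ht => Γ.arc_mem_carrier he' ht
    · by_cases he' : e' = e
      · simpa [he'] using hke t ht
      · simpa [he'] using hLe _ (Γ.arc_mem_carrier he' ht)
    · simp [he', Γ.arc_zero, Γ.arc_one]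
    · simpa using hn
  choose l lam n hl hle hco hn using hlog
  obtain ⟨α, β, hαβ, hsum⟩ : ∃ α β : ℤ, (α ≠ 0 ∨ β ≠ 0) ∧ α * n 1 + β * n 2 = 0 := by
    by_cases h : n 1 = 0
    · exact ⟨1, 0, by simp, by simp [h]⟩
    · exact ⟨n 2, -n 1, by simp [h], by ring⟩
  have hne : ∀ j, ∀ z ∈ Γ.carrier univ, z - x j ≠ 0 := fun j z hz h =>
    hx j (sub_eq_zero.1 h ▸ hz)
  let a : Fin 3 → ℤ := ![-(α + β), α, β]
  have hprod : ∀ z ∈ Γ.carrier univ, ((z - x 1) / (z - x 0)) ^ α * ((z - x 2) / (z - x 0)) ^ β =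
      ∏ i, (z - x i) ^ a i := by
    intro z hz
    simp only [Fin.prod_univ_three, a, Matrix.cons_val_zero, Matrix.cons_val_one,
      Matrix.cons_val]
    rw [div_zpow, div_zpow, zpow_neg, zpow_add₀ (hne 0 z hz)]
    have := zpow_ne_zero α (hne 0 z hz)
    have := zpow_ne_zero β (hne 0 z hz)
    field_simp
  obtain ⟨G, hG, hGe⟩ := Γ.exists_log_carrier (S := univ)
    (h := fun z => ∏ i, (z - x i) ^ a i)
    (l := fun e t => α * l 1 e t + β * l 2 e t) (lam := fun v => α * lam 1 v + β * lam 2 v)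
    (fun z hz => Finset.prod_ne_zero_iff.2 fun i _ => zpow_ne_zero _ (hne i z hz))
    (fun e _ => (continuousOn_const.mul (hl 1 e)).add (continuousOn_const.mul (hl 2 e)))
    (fun e _ t ht => by
      rw [← hprod _ (Γ.arc_mem_carrier (mem_univ e) ht), ← hle 1 e t ht, ← hle 2 e t ht,
        Complex.exp_add, Complex.exp_int_mul, Complex.exp_int_mul])
    (fun e' _ => by
      by_cases he' : e' = e
      · subst he'
        have h1 := hn 1
        have h2 := hn 2
        have h3 : (α : ℂ) * n 1 + β * n 2 = 0 := by exact_mod_cast hsum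
        linear_combination (α : ℂ) * h1 + (β : ℂ) * h2 + (2 * Real.pi * Complex.I) * h3
      · have h1 := hco 1 e' he'
        have h2 := hco 2 e' he'
        linear_combination (α : ℂ) * h1 + (β : ℂ) * h2)
  have ha := exponent_eq_zero (Γ.isCompact_carrier univ) hx hinj (a := a)
    (by simp [Fin.sum_univ_three, a]) hG hGe
  rcases hαβ with h | h
  · exact h (ha 1)
  · exact h (ha 2)

section Cycles

variable [Fintype E]

variable (Γ) in
open Classical in
/-- The boundary map of the oriented graph, with complex coefficients. -/
noncomputable def boundary : (E → ℂ) →ₗ[ℂ] (N → ℂ) :=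
  Fintype.linearCombination ℂ fun e => Pi.single (Γ.tgt e) 1 - Pi.single (Γ.src e) 1

theorem boundary_apply (r : E → ℂ) (φ : (N → ℂ) →ₗ[ℂ] ℂ) : φ (Γ.boundary r) =
    ∑ e, r e * (φ (by classical exact Pi.single (Γ.tgt e) 1) -
      φ (by classical exact Pi.single (Γ.src e) 1)) := by
  simp [boundary, Fintype.linearCombination_apply]

theorem sum_cycle [Fintype N] {r : E → ℂ} (hr : Γ.boundary r = 0) (φ : N → ℂ) :
    ∑ e, r e * (φ (Γ.tgt e) - φ (Γ.src e)) = 0 := by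
  classical
  have := Γ.boundary_apply r (Fintype.linearCombination ℂ φ)
  rw [hr, map_zero] at this
  rw [this]
  refine Finset.sum_congr rfl fun e _ => ?_
  simp [Fintype.linearCombination_apply, Pi.single_apply]

/-- A set of edges supporting no cycle supports only coboundaries. -/
theorem exists_potential {S : Set E}
    (hS : ∀ r, Γ.boundary r = 0 → (∀ e, r e ≠ 0 → e ∈ S) → r = 0) (c : E → ℂ) :
    ∃ lam : N → ℂ, ∀ e ∈ S, lam (Γ.tgt e) - lam (Γ.src e) = c e := by
  classical
  let W : Submodule ℂ (E → ℂ) :=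
    { carrier := {r | ∀ e, e ∉ S → r e = 0}
      add_mem' := fun {a b} ha hb e he => by simp [ha e he, hb e he]
      zero_mem' := fun e _ => rfl
      smul_mem' := fun k a ha e he => by simp [ha e he] }
  have hinj : LinearMap.ker (Γ.boundary ∘ₗ W.subtype) = ⊥ := by
    rw [LinearMap.ker_eq_bot']
    intro r hr
    ext1
    exact hS r hr fun e he => by_contra fun h => he (r.2 e h)
  obtain ⟨g, hg⟩ := LinearMap.exists_leftInverse_of_injective _ hinj
  let φ : (N → ℂ) →ₗ[ℂ] ℂ := Fintype.linearCombination ℂ c ∘ₗ W.subtype ∘ₗ g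
  refine ⟨fun v => φ (Pi.single v 1), fun e he => ?_⟩
  let w : W := ⟨Pi.single e 1, fun e' he' => by
    rw [Pi.single_eq_of_ne]; rintro rfl; exact he' he⟩
  have h1 : φ (Γ.boundary w) = c e := by
    have : g (Γ.boundary w) = w := LinearMap.congr_fun hg w
    simp only [φ, LinearMap.comp_apply, this]
    simp [w, Fintype.linearCombination_apply, Pi.single_apply]
  rw [← h1, boundary_apply]
  rw [Fintype.sum_eq_single e fun e' he' => by simp [w, he']]
  simp only [w, Pi.single_eq_same, one_mul]

/-- The edges on the boundary of a face that is not the only one support a cycle. -/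
theorem exists_cycle_touches [Finite N] {x y : ℂ} (hx : x ∉ Γ.carrier univ)
    (hy : y ∉ Γ.carrier univ)
    (hxy : connectedComponentIn (Γ.carrier univ)ᶜ x ≠ connectedComponentIn (Γ.carrier univ)ᶜ y) :
    ∃ r, Γ.boundary r = 0 ∧ r ≠ 0 ∧ ∀ e, r e ≠ 0 → Γ.Touches x e := by
  by_contra! hcon
  let S : Set E := {e | Γ.Touches x e}
  have hsub : Γ.carrier S ⊆ Γ.carrier univ := carrier_mono (subset_univ _)
  have hS : ∀ r, Γ.boundary r = 0 → (∀ e, r e ≠ 0 → e ∈ S) → r = 0 := by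
    intro r hr hrS
    by_contra h0
    obtain ⟨e, he, hne⟩ := hcon r hr h0
    exact hne (hrS e he)
  set F := connectedComponentIn (Γ.carrier univ)ᶜ x with hF
  have hFo : IsOpen F := (Γ.isCompact_carrier univ).isClosed.isOpen_compl.connectedComponentIn
  have hfr : frontier F ⊆ Γ.carrier S := by
    intro z hz
    rcases frontier_connectedComponentIn_subset (Γ.isCompact_carrier univ).isClosed x hz with
      h | h
    · exact .inl h
    · simp only [mem_iUnion] at h
      obtain ⟨e, -, t, ht, rfl⟩ := h
      rcases eq_zero_or_mem_Ioo_or_eq_one ht with rfl | h' | rfl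
      · rw [Γ.arc_zero]; exact Γ.pos_mem_carrier _ _
      · exact Γ.arc_mem_carrier (S := S) ⟨t, h', hz.1⟩ ht
      · rw [Γ.arc_one]; exact Γ.pos_mem_carrier _ _
  have hxF : x ∈ F := mem_connectedComponentIn hx
  have hsep : connectedComponentIn (Γ.carrier S)ᶜ x ⊆ F := by
    by_contra hnot
    obtain ⟨z, hz, hzF⟩ := not_subset.1 hnot
    have := isPreconnected_connectedComponentIn (F := (Γ.carrier S)ᶜ) (x := x)
    obtain ⟨w, hw, hwF⟩ := this F (closure F)ᶜ hFo isClosed_closure.isOpen_compl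
      (fun w hw => by
        by_cases h : w ∈ closure F
        · left
          by_contra h'
          exact connectedComponentIn_subset _ _ hw (hfr ⟨h, by rwa [hFo.interior_eq]⟩)
        · exact .inr h)
      ⟨x, mem_connectedComponentIn fun h => hx (hsub h), hxF⟩
      ⟨z, hz, fun h => connectedComponentIn_subset _ _ hz (hfr ⟨h, by rwa [hFo.interior_eq]⟩)⟩
    exact hwF.2 (subset_closure hwF.1)
  have hcomp : connectedComponentIn (Γ.carrier S)ᶜ x ≠ connectedComponentIn (Γ.carrier S)ᶜ y := by
    intro h
    have : y ∈ F := hsep (h ▸ mem_connectedComponentIn fun h => hy (hsub h))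
    exact hxy (connectedComponentIn_eq this)
  have hnex : ∀ z ∈ Γ.carrier S, z - x ≠ 0 := fun z hz h => hx (sub_eq_zero.1 h ▸ hsub hz)
  have hney : ∀ z ∈ Γ.carrier S, z - y ≠ 0 := fun z hz h => hy (sub_eq_zero.1 h ▸ hsub hz)
  have hlift : ∀ e, ∃ l : ℝ → ℂ, e ∈ S → ContinuousOn l (Icc 0 1) ∧
      ∀ t ∈ Icc (0 : ℝ) 1, Complex.exp (l t) = (Γ.arc e t - x) / (Γ.arc e t - y) := by
    intro e
    by_cases he : e ∈ S
    · obtain ⟨l, hl⟩ := exists_log_Icc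
        (h := fun t => (Γ.arc e t - x) / (Γ.arc e t - y))
        (((Γ.arc_cont e).sub continuousOn_const).div ((Γ.arc_cont e).sub continuousOn_const)
          fun t ht => hney _ (Γ.arc_mem_carrier he ht))
        fun t ht => div_ne_zero (hnex _ (Γ.arc_mem_carrier he ht))
          (hney _ (Γ.arc_mem_carrier he ht))
      exact ⟨l, fun _ => hl⟩
    · exact ⟨0, fun h => absurd h he⟩
  choose l hl using hlift
  obtain ⟨lam, hlam⟩ := Γ.exists_potential hS fun e => l e 1 - l e 0
  obtain ⟨G, hG, hGe⟩ := Γ.exists_log_carrier (S := S) (h := fun z => (z - x) / (z - y))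
    (fun z hz => div_ne_zero (hnex z hz) (hney z hz)) (fun e he => (hl e he).1)
    (fun e he => (hl e he).2) hlam
  have := exponent_eq_zero (Γ.isCompact_carrier S) (x := ![x, y]) (a := ![1, -1]) (G := G)
    (by
      intro i
      fin_cases i
      · exact fun h => hx (hsub h)
      · exact fun h => hy (hsub h))
    (by
      intro i j hij
      fin_cases i <;> fin_cases j
      · rfl
      · exact absurd hij hcomp
      · exact absurd hij.symm hcomp
      · rfl)
    (by simp) hG (fun z hz => by rw [hGe z hz]; simp [div_eq_mul_inv]) 0
  simp at this

end Cycles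

end PlaneGraph

/-- The form `dz / (z - p) - dz / (z - q)` has no primitive on the complement of `{p, q}`. -/
theorem not_hasDerivAt_inv_sub_inv {p q : ℂ} (hpq : p ≠ q) {M : ℂ → ℂ}
    (hM : ∀ z, z ≠ p → z ≠ q → HasDerivAt M ((z - p)⁻¹ - (z - q)⁻¹) z) : False := by
  set ρ : ℝ := ‖q - p‖ / 2 with hρ
  have hρ0 : 0 < ρ := half_pos (norm_pos_iff.2 (sub_ne_zero.2 hpq.symm))
  have hq : q ∉ Metric.closedBall p ρ := by
    rw [Metric.mem_closedBall, dist_eq_norm]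
    linarith
  have hqz : ∀ z ∈ Metric.closedBall p ρ, z - q ≠ 0 := fun z hz h => hq (sub_eq_zero.1 h ▸ hz)
  have h1 : (∮ z in C(p, ρ), ((z - p)⁻¹ - (z - q)⁻¹)) = 0 :=
    circleIntegral.integral_eq_zero_of_hasDerivWithinAt hρ0.le fun z hz =>
      (hM z (Metric.ne_of_mem_sphere hz hρ0.ne')
        (fun h => hqz z (Metric.sphere_subset_closedBall hz) (sub_eq_zero.2 h))).hasDerivWithinAt
  have hc : ContinuousOn (fun z => (z - q)⁻¹) (Metric.closedBall p ρ) :=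
    (continuousOn_id.sub continuousOn_const).inv₀ hqz
  have h2 : (∮ z in C(p, ρ), (z - q)⁻¹) = 0 := by
    refine Complex.circleIntegral_eq_zero_of_differentiable_on_off_countable hρ0.le
      countable_empty hc fun z hz => ?_
    exact (differentiableAt_id.sub_const q).inv (hqz z (Metric.ball_subset_closedBall hz.1))
  have hi : CircleIntegrable (fun z => (z - p)⁻¹) p ρ := by
    refine ContinuousOn.circleIntegrable hρ0.le ?_
    exact (continuousOn_id.sub continuousOn_const).inv₀ fun z hz =>
      sub_ne_zero.2 (Metric.ne_of_mem_sphere hz hρ0.ne')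
  rw [circleIntegral.integral_sub hi
    ((hc.mono Metric.sphere_subset_closedBall).circleIntegrable hρ0.le), h2,
    circleIntegral.integral_sub_center_inv p hρ0.ne'] at h1
  simp [Real.pi_ne_zero] at h1

namespace PlaneGraph

variable {N E : Type*} (Γ : PlaneGraph N E)

/-- The faces of a plane graph: the components of the complement of its carrier. -/
def Face : Type := {F : Set ℂ // ∃ x ∉ Γ.carrier univ, connectedComponentIn (Γ.carrier univ)ᶜ x = F}

/-- A point in a given face. -/
noncomputable def Face.point (F : Γ.Face) : ℂ := F.2.choose

variable {Γ}

theorem Face.point_notMem (F : Γ.Face) : F.point ∉ Γ.carrier univ := F.2.choose_spec.1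

theorem Face.component_point (F : Γ.Face) :
    connectedComponentIn (Γ.carrier univ)ᶜ F.point = F.1 := F.2.choose_spec.2

theorem Face.component_injective :
    Function.Injective fun F : Γ.Face => connectedComponentIn (Γ.carrier univ)ᶜ F.point := by
  intro F F' h
  simp only [Face.component_point] at h
  exact Subtype.ext h

/-- The primitive of `dz / (z - p) - dz / (z - q)` on the complement of an edge from `p` to `q`. -/
theorem exists_primitive (e : E) : ∃ L : ℂ → ℂ, ∀ z ∉ Γ.arc e '' Icc 0 1,
    HasDerivAt L ((z - Γ.pos (Γ.src e))⁻¹ - (z - Γ.pos (Γ.tgt e))⁻¹) z := by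
  obtain ⟨L, hL, hLe⟩ := exists_log_compl_path (Γ.arc_cont e)
  have hopen : IsOpen (Γ.arc e '' Icc 0 1)ᶜ :=
    (isCompact_Icc.image_of_continuousOn (Γ.arc_cont e)).isClosed.isOpen_compl
  refine ⟨L, fun z hz => ?_⟩
  rw [Γ.arc_zero, Γ.arc_one] at hLe
  have hp : z - Γ.pos (Γ.src e) ≠ 0 := fun h =>
    hz ⟨0, by simp, (Γ.arc_zero e).trans (sub_eq_zero.1 h).symm⟩
  have hq : z - Γ.pos (Γ.tgt e) ≠ 0 := fun h =>
    hz ⟨1, by simp, (Γ.arc_one e).trans (sub_eq_zero.1 h).symm⟩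
  have hd : HasDerivAt (fun z => (z - Γ.pos (Γ.src e)) / (z - Γ.pos (Γ.tgt e)))
      ((1 * (z - Γ.pos (Γ.tgt e)) - (z - Γ.pos (Γ.src e)) * 1) / (z - Γ.pos (Γ.tgt e)) ^ 2) z :=
    ((hasDerivAt_id z).sub_const _).div ((hasDerivAt_id z).sub_const _) hq
  convert hasDerivAt_of_exp_eventuallyEq (hL.continuousAt (hopen.mem_nhds hz))
    (Filter.eventually_of_mem (hopen.mem_nhds hz) hLe) hd using 1
  field_simp

/-- The number of faces exceeds the cycle rank. -/
theorem finrank_ker_boundary_lt [Fintype N] [Fintype E] [Finite Γ.Face] :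
    Module.finrank ℂ (LinearMap.ker Γ.boundary) + 1 ≤ Nat.card Γ.Face := by
  classical
  have := Fintype.ofFinite Γ.Face
  choose L hL using fun e => Γ.exists_primitive e
  set K := Γ.carrier univ with hK
  have hKc : IsCompact K := Γ.isCompact_carrier univ
  have hKo : IsOpen Kᶜ := hKc.isClosed.isOpen_compl
  have hLK : ∀ z ∉ K, ∀ e, HasDerivAt (L e)
      ((z - Γ.pos (Γ.src e))⁻¹ - (z - Γ.pos (Γ.tgt e))⁻¹) z := fun z hz e => hL e z fun h =>
    hz (.inr (mem_biUnion (mem_univ e) h))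
  let W : (E → ℂ) → ℂ → ℂ → ℂ := fun r c z => ∑ e, r e * L e z + c
  have hW0 : ∀ r c, Γ.boundary r = 0 → (∀ F : Γ.Face, W r c F.point = 0) →
      ∀ z ∉ K, W r c z = 0 := by
    intro r c hr hF z hz
    have hd : ∀ z ∉ K, HasDerivAt (W r c) 0 z := by
      intro z hz
      have h1 : HasDerivAt (W r c)
          (∑ e, r e * ((z - Γ.pos (Γ.src e))⁻¹ - (z - Γ.pos (Γ.tgt e))⁻¹)) z := by
        refine HasDerivAt.add_const _ (HasDerivAt.fun_sum fun e _ => (hLK z hz e).const_mul _)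
      convert h1 using 1
      have := Γ.sum_cycle hr fun v => -(z - Γ.pos v)⁻¹
      rw [← this]
      exact Finset.sum_congr rfl fun e _ => by ring
    let F : Γ.Face := ⟨_, z, hz, rfl⟩
    rw [← hF F]
    have hzF : z ∈ connectedComponentIn Kᶜ z := mem_connectedComponentIn hz
    have hpF : F.point ∈ connectedComponentIn Kᶜ z := by
      have : connectedComponentIn Kᶜ F.point = connectedComponentIn Kᶜ z := F.component_point
      rw [← this]
      exact mem_connectedComponentIn F.point_notMem
    have hsub := connectedComponentIn_subset Kᶜ z
    exact hKo.connectedComponentIn.is_const_of_deriv_eq_zero isPreconnected_connectedComponentIn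
      (fun w hw => (hd w (hsub hw)).differentiableAt.differentiableWithinAt)
      (fun w hw => (hd w (hsub hw)).deriv) hzF hpF
  have hr0 : ∀ r c, Γ.boundary r = 0 → (∀ z ∉ K, W r c z = 0) → r = 0 := by
    intro r c hr hW
    funext e₀
    by_contra hre
    simp only [Pi.zero_apply] at hre
    set K' := Γ.carrier {e₀}ᶜ with hK'
    set A := Γ.arc e₀ '' Icc 0 1 with hA
    have hAo : IsOpen Aᶜ :=
      (isCompact_Icc.image_of_continuousOn (Γ.arc_cont e₀)).isClosed.isOpen_compl
    have hK'o : IsOpen K'ᶜ := (Γ.isCompact_carrier {e₀}ᶜ).isClosed.isOpen_compl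
    let R : ℂ → ℂ := fun z => -(r e₀)⁻¹ * (∑ e ∈ Finset.univ.erase e₀, r e * L e z + c)
    have hLR : ∀ z, z ∉ A → z ∉ K' → L e₀ z = R z := by
      intro z hz hz'
      have hzK : z ∉ K := by
        rintro (h | h)
        · exact hz' (.inl h)
        · simp only [mem_iUnion] at h
          obtain ⟨e, -, h⟩ := h
          by_cases he : e = e₀
          · subst he; exact hz h
          · exact hz' (.inr (mem_biUnion (by simpa using he) h))
      have := hW z hzK
      simp only [W, ← Finset.add_sum_erase _ _ (Finset.mem_univ e₀)] at this
      simp only [R]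
      field_simp
      linear_combination this
    refine not_hasDerivAt_inv_sub_inv (Γ.pos_inj.ne (Γ.src_ne_tgt e₀))
      (M := fun z => if z ∈ A then R z else L e₀ z) fun z hzp hzq => ?_
    by_cases hzA : z ∈ A
    · have hzK' : z ∉ K' := by
        obtain ⟨t, ht, rfl⟩ := hzA
        rcases eq_zero_or_mem_Ioo_or_eq_one ht with rfl | h | rfl
        · exact absurd (Γ.arc_zero e₀) hzp
        · exact Γ.arc_notMem_carrier (by simp) h
        · exact absurd (Γ.arc_one e₀) hzq
      have hd : HasDerivAt R (-(r e₀)⁻¹ * ∑ e ∈ Finset.univ.erase e₀,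
          r e * ((z - Γ.pos (Γ.src e))⁻¹ - (z - Γ.pos (Γ.tgt e))⁻¹)) z := by
        refine HasDerivAt.const_mul _ (HasDerivAt.add_const _ (HasDerivAt.fun_sum fun e he =>
          (hL e z fun h => hzK' ?_).const_mul _))
        exact .inr (mem_biUnion (by simpa using he) h)
      have hs := Γ.sum_cycle hr fun v => -(z - Γ.pos v)⁻¹
      rw [← Finset.add_sum_erase _ _ (Finset.mem_univ e₀)] at hs
      have hs' : ∑ e ∈ Finset.univ.erase e₀,
          r e * ((z - Γ.pos (Γ.src e))⁻¹ - (z - Γ.pos (Γ.tgt e))⁻¹) =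
          -(r e₀ * ((z - Γ.pos (Γ.src e₀))⁻¹ - (z - Γ.pos (Γ.tgt e₀))⁻¹)) := by
        rw [eq_neg_iff_add_eq_zero, ← hs, add_comm]
        congr 1
        · ring
        · exact Finset.sum_congr rfl fun e _ => by ring
      have hval : -(r e₀)⁻¹ * ∑ e ∈ Finset.univ.erase e₀,
          r e * ((z - Γ.pos (Γ.src e))⁻¹ - (z - Γ.pos (Γ.tgt e))⁻¹) =
          (z - Γ.pos (Γ.src e₀))⁻¹ - (z - Γ.pos (Γ.tgt e₀))⁻¹ := by
        rw [hs', neg_mul_neg, ← mul_assoc, inv_mul_cancel₀ hre, one_mul]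
      rw [hval] at hd
      refine hd.congr_of_eventuallyEq ?_
      filter_upwards [hK'o.mem_nhds hzK'] with w hw
      by_cases hwA : w ∈ A
      · simp [hwA]
      · simp [hwA, hLR w hwA hw]
    · refine (hL e₀ z hzA).congr_of_eventuallyEq ?_
      filter_upwards [hAo.mem_nhds hzA] with w hw
      exact if_neg hw
  let Φ : (LinearMap.ker Γ.boundary × ℂ) →ₗ[ℂ] (Γ.Face → ℂ) :=
    { toFun := fun x F => W x.1 x.2 F.point
      map_add' := fun x y => by
        funext F
        simp only [W, Prod.fst_add, Prod.snd_add, Submodule.coe_add, Pi.add_apply, add_mul,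
          Finset.sum_add_distrib]
        ring
      map_smul' := fun k x => by
        funext F
        simp only [W, Prod.smul_fst, Prod.smul_snd, Submodule.coe_smul, Pi.smul_apply, smul_eq_mul,
          mul_add, Finset.mul_sum, mul_assoc, RingHom.id_apply] }
  have hΦ : Function.Injective Φ := by
    rw [← LinearMap.ker_eq_bot, LinearMap.ker_eq_bot']
    rintro ⟨⟨r, hr⟩, c⟩ h
    rw [LinearMap.mem_ker] at hr
    have hW := hW0 r c hr fun F => congrFun h F
    have hr' := hr0 r c hr hW
    obtain ⟨z, hz⟩ := (ne_univ_iff_exists_notMem _).1 hKc.ne_univ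
    have hc := hW z hz
    subst hr'
    simp only [W, Pi.zero_apply, zero_mul, Finset.sum_const_zero, zero_add] at hc
    subst hc
    rfl
  have := LinearMap.finrank_le_finrank_of_injective hΦ
  simpa [Nat.card_eq_fintype_card] using this

/-- Euler's bound: if every cycle has at least `g` edges, then the graph is a forest or
`g * (|E| - |N| + 2) ≤ 2 * |E|`. -/
theorem card_edges_bound [Fintype N] [Nonempty N] [Fintype E] {g : ℕ} (hg0 : 0 < g)
    (hg : ∀ r, Γ.boundary r = 0 → r ≠ 0 → g ≤ Nat.card {e // r e ≠ 0}) :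
    Fintype.card E + 1 ≤ Fintype.card N ∨
      g * (Fintype.card E + 2) ≤ 2 * Fintype.card E + g * Fintype.card N := by
  classical
  have hrank := LinearMap.finrank_range_add_finrank_ker Γ.boundary
  rw [Module.finrank_fintype_fun_eq_card] at hrank
  have hlt : Module.finrank ℂ (LinearMap.range Γ.boundary) < Fintype.card N := by
    rw [← Module.finrank_fintype_fun_eq_card (R := ℂ) (η := N)]
    refine Submodule.finrank_lt fun h => ?_
    obtain ⟨v⟩ := ‹Nonempty N›
    obtain ⟨r, hr⟩ := LinearMap.range_eq_top.1 h (Pi.single v 1)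
    have := Γ.boundary_apply r (Fintype.linearCombination ℂ fun _ => 1)
    rw [hr] at this
    simp [Fintype.linearCombination_apply, Pi.single_apply] at this
  by_cases hker : Module.finrank ℂ (LinearMap.ker Γ.boundary) = 0
  · left; omega
  right
  have hnontriv : Nontrivial Γ.Face := by
    by_contra hn
    rw [not_nontrivial_iff_subsingleton] at hn
    have h1 := Γ.finrank_ker_boundary_lt
    have h2 : Nat.card Γ.Face ≤ 1 := Finite.card_le_one_iff_subsingleton.2 hn
    omega
  have hcount : ∀ Φ : Finset Γ.Face, g * Φ.card ≤ 2 * Fintype.card E := by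
    intro Φ
    have h1 : ∀ F ∈ Φ, g ≤ (Finset.univ.filter fun e => Γ.Touches F.point e).card := by
      intro F _
      obtain ⟨F', hF'⟩ := exists_ne F
      obtain ⟨r, hr, hr0, ht⟩ := Γ.exists_cycle_touches F.point_notMem F'.point_notMem
        (Face.component_injective.ne hF'.symm)
      refine (hg r hr hr0).trans ?_
      rw [Nat.card_eq_fintype_card, Fintype.card_subtype]
      exact Finset.card_le_card fun e he => by
        simp only [Finset.mem_filter, Finset.mem_univ, true_and] at he ⊢
        exact ht e he
    have h2 : ∀ e ∈ (Finset.univ : Finset E),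
        (Φ.filter fun F => Γ.Touches F.point e).card ≤ 2 := by
      intro e _
      by_contra! h
      obtain ⟨F, F', F'', hF, hF', hF'', h1, h2, h3⟩ := Finset.two_lt_card_iff.1 h
      rw [Finset.mem_filter] at hF hF' hF''
      let f : Fin 3 → Γ.Face := ![F, F', F'']
      have hf : Function.Injective f := by
        intro i j hij
        fin_cases i <;> fin_cases j <;> simp_all [f, eq_comm]
      refine Γ.not_touches_three e (x := fun i => (f i).point) (fun i => (f i).point_notMem)
        (Face.component_injective.comp hf) fun i => ?_
      fin_cases i
      · exact hF.2
      · exact hF'.2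
      · exact hF''.2
    have h3 := Finset.sum_card_bipartiteAbove_eq_sum_card_bipartiteBelow
      (s := Φ) (t := (Finset.univ : Finset E)) fun F e => Γ.Touches F.point e
    have h4 := Finset.card_nsmul_le_sum _ _ _ h1
    have h5 := Finset.sum_le_card_nsmul _ _ _ h2
    simp only [Finset.bipartiteAbove, Finset.bipartiteBelow] at h3
    simp only [smul_eq_mul, Finset.card_univ] at h4 h5
    calc g * Φ.card = Φ.card * g := mul_comm _ _
      _ ≤ _ := h4
      _ = _ := h3
      _ ≤ _ := h5
      _ = _ := mul_comm _ _
  have hfin : Finite Γ.Face := by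
    by_contra hinf
    rw [not_finite_iff_infinite] at hinf
    obtain ⟨Φ, hΦ⟩ := Infinite.exists_subset_card_eq Γ.Face (2 * Fintype.card E + 1)
    have := hcount Φ
    rw [hΦ] at this
    have := Nat.le_mul_of_pos_left (2 * Fintype.card E + 1) hg0
    omega
  have := Fintype.ofFinite Γ.Face
  have h1 := Γ.finrank_ker_boundary_lt
  rw [Nat.card_eq_fintype_card] at h1
  have h2 := hcount Finset.univ
  rw [Finset.card_univ] at h2
  have h3 : Fintype.card E + 2 ≤ Fintype.card Γ.Face + Fintype.card N := by omega
  calc g * (Fintype.card E + 2) ≤ g * (Fintype.card Γ.Face + Fintype.card N) :=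
        Nat.mul_le_mul_left _ h3
    _ = g * Fintype.card Γ.Face + g * Fintype.card N := mul_add _ _ _
    _ ≤ _ := Nat.add_le_add_right h2 _

end PlaneGraph

namespace PlaneGraph

variable {N E : Type*} {Γ : PlaneGraph N E} [Fintype N] [Fintype E]

/-- In the support of a cycle no vertex has degree one. -/
theorem exists_ne_incident {r : E → ℂ} (hr : Γ.boundary r = 0) {e : E} (he : r e ≠ 0) {v : N}
    (hv : Γ.src e = v ∨ Γ.tgt e = v) :
    ∃ e', e' ≠ e ∧ r e' ≠ 0 ∧ (Γ.src e' = v ∨ Γ.tgt e' = v) := by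
  classical
  by_contra! H
  have h := Γ.sum_cycle hr (fun w => if w = v then 1 else 0)
  rw [Finset.sum_eq_single e] at h
  · have hne := Γ.src_ne_tgt e
    rcases hv with rfl | rfl
    · simp [he, hne.symm] at h
    · simp [he, hne] at h
  · intro e' _ hne
    by_cases h0 : r e' = 0
    · simp [h0]
    · obtain ⟨h1, h2⟩ := H e' hne h0
      simp [h1, h2]
  · simp

theorem le_card_support {r : E → ℂ} {T : Finset E} (hT : ∀ e ∈ T, r e ≠ 0) :
    T.card ≤ Nat.card {e // r e ≠ 0} := by
  classical
  rw [Nat.card_eq_fintype_card, Fintype.card_subtype]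
  exact Finset.card_le_card fun e he => by simpa using hT e he

/-- A simple plane graph with `n ≥ 3` vertices has at most `3 * n - 6` edges. -/
theorem card_edges_le_of_simple (hN : 3 ≤ Fintype.card N)
    (hs : ∀ e e', s(Γ.src e, Γ.tgt e) = s(Γ.src e', Γ.tgt e') → e = e') :
    Fintype.card E + 6 ≤ 3 * Fintype.card N := by
  classical
  have : Nonempty N := Fintype.card_pos_iff.1 (by omega)
  have h := Γ.card_edges_bound (g := 3) (by norm_num) ?_
  · omega
  intro r hr hr0
  obtain ⟨e, he⟩ := Function.ne_iff.1 hr0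
  obtain ⟨a, hae, ha, hav⟩ := exists_ne_incident hr he (v := Γ.src e) (.inl rfl)
  obtain ⟨b, hbe, hb, hbv⟩ := exists_ne_incident hr he (v := Γ.tgt e) (.inr rfl)
  have hab : a ≠ b := by
    rintro rfl
    have hne := Γ.src_ne_tgt e
    refine hae (hs _ _ ?_)
    rw [Sym2.eq_iff]
    grind
  have hcard : ({e, a, b} : Finset E).card = 3 := by
    rw [Finset.card_eq_three]
    exact ⟨e, a, b, hae.symm, hbe.symm, hab, rfl⟩
  rw [← hcard]
  refine le_card_support ?_
  simp only [Finset.mem_insert, Finset.mem_singleton]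
  rintro x (rfl | rfl | rfl) <;> assumption

/-- The Euler bound for a plane bipartite graph without `4`-cycles. -/
theorem card_edges_le_of_linear {V C : Type*} [Fintype V] [Fintype C] [Nonempty V]
    {Γ : PlaneGraph (V ⊕ C) E} {c : E → C} {w : E → V}
    (hsrc : ∀ e, Γ.src e = .inr (c e)) (htgt : ∀ e, Γ.tgt e = .inl (w e))
    (hs : ∀ e e', c e = c e' → w e = w e' → e = e')
    (hlin : ∀ e₁ e₂ e₃ e₄, c e₁ = c e₂ → c e₃ = c e₄ → w e₁ = w e₃ → w e₂ = w e₄ →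
      w e₁ ≠ w e₂ → c e₁ = c e₃) :
    Fintype.card E + 1 ≤ Fintype.card V + Fintype.card C ∨
      4 * Fintype.card E + 12 ≤ 6 * (Fintype.card V + Fintype.card C) := by
  classical
  have h := Γ.card_edges_bound (g := 6) (by norm_num) ?_
  · rw [Fintype.card_sum] at h
    omega
  intro r hr hr0
  have atV : ∀ e, r e ≠ 0 → ∃ e', e' ≠ e ∧ r e' ≠ 0 ∧ w e' = w e := fun e he => by
    obtain ⟨e', h1, h2, h3⟩ := exists_ne_incident hr he (.inr (htgt e))
    exact ⟨e', h1, h2, by simpa [hsrc, htgt] using h3⟩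
  have atC : ∀ e, r e ≠ 0 → ∃ e', e' ≠ e ∧ r e' ≠ 0 ∧ c e' = c e := fun e he => by
    obtain ⟨e', h1, h2, h3⟩ := exists_ne_incident hr he (.inl (hsrc e))
    exact ⟨e', h1, h2, by simpa [hsrc, htgt] using h3⟩
  obtain ⟨e, he⟩ := Function.ne_iff.1 hr0
  obtain ⟨f, hfe, hf, hwf⟩ := atV e he
  obtain ⟨a, hae, ha, hca⟩ := atC e he
  obtain ⟨b, hbf, hb, hcb⟩ := atC f hf
  obtain ⟨a', haa, ha', hwa⟩ := atV a ha
  obtain ⟨b', hbb, hb', hwb⟩ := atV b hb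
  have hwae : w a ≠ w e := fun h => hae (hs _ _ hca h)
  have hwbf : w b ≠ w f := fun h => hbf (hs _ _ hcb h)
  have hwab : w a ≠ w b := fun h =>
    hfe (hs _ _ (hlin e a f b hca.symm hcb.symm hwf.symm h hwae.symm).symm hwf)
  have hcard : ({e, f, a, a', b, b'} : Finset E).card = 6 := by
    rw [Finset.card_insert_of_notMem, Finset.card_insert_of_notMem, Finset.card_insert_of_notMem,
      Finset.card_insert_of_notMem, Finset.card_insert_of_notMem, Finset.card_singleton]
    all_goals simp only [Finset.mem_insert, Finset.mem_singleton]; grind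
  rw [← hcard]
  refine le_card_support ?_
  simp only [Finset.mem_insert, Finset.mem_singleton]
  rintro x (rfl | rfl | rfl | rfl | rfl | rfl) <;> assumption

end PlaneGraph

namespace Drawing

variable {V : Type*} {G : SimpleGraph V} (D : Drawing G)

theorem arc_notMem_range_pos (e : G.edgeSet) {t : ℝ} (ht : t ∈ Ioo (0 : ℝ) 1) :
    D.arc e t ∉ range D.pos := by
  rintro ⟨v, hv⟩
  obtain ⟨x, y, hxy, h0, h1⟩ := D.arc_ends e
  by_cases hve : v ∈ (e : Sym2 V)
  · rw [hxy, Sym2.mem_iff] at hve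
    rcases hve with rfl | rfl
    · exact ht.1.ne' (D.arc_inj e (Ioo_subset_Icc_self ht) (by simp) (hv.symm.trans h0.symm))
    · exact ht.2.ne (D.arc_inj e (Ioo_subset_Icc_self ht) (by simp) (hv.symm.trans h1.symm))
  · exact D.no_vertex_interior e v hve ⟨t, Ioo_subset_Icc_self ht, hv.symm⟩

theorem exists_mem_Ioo_of_mem_arcIm {e : G.edgeSet} {p : ℝ × ℝ} (hp : p ∈ D.arcIm e)
    (hp' : p ∉ range D.pos) : ∃ t ∈ Ioo (0 : ℝ) 1, D.arc e t = p := by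
  obtain ⟨t, ht, rfl⟩ := hp
  obtain ⟨x, y, -, h0, h1⟩ := D.arc_ends e
  rcases eq_zero_or_mem_Ioo_or_eq_one ht with rfl | ht | rfl
  · exact absurd ⟨x, h0.symm⟩ hp'
  · exact ⟨t, ht, rfl⟩
  · exact absurd ⟨y, h1.symm⟩ hp'

theorem arc_mem_arcIm (e : G.edgeSet) {t : ℝ} (ht : t ∈ Ioo (0 : ℝ) 1) : D.arc e t ∈ D.arcIm e :=
  ⟨t, Ioo_subset_Icc_self ht, rfl⟩

theorem mem_crossings_of_arc_eq_arc {e e' : G.edgeSet} (hne : e ≠ e') {t t' : ℝ}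
    (ht : t ∈ Ioo (0 : ℝ) 1) (ht' : t' ∈ Ioo (0 : ℝ) 1) (h : D.arc e t = D.arc e' t') :
    D.arc e t ∈ D.crossings :=
  ⟨D.arc_notMem_range_pos e ht, e, e', hne, D.arc_mem_arcIm e ht, h ▸ D.arc_mem_arcIm e' ht'⟩

theorem arc_cont_complex (e : G.edgeSet) :
    ContinuousOn (fun t => Complex.equivRealProdCLM.symm (D.arc e t)) (Icc 0 1) :=
  Complex.equivRealProdCLM.symm.continuous.comp_continuousOn (D.arc_cont e)

theorem exists_injective_edge (hD : D.IsOnePlanar) : ∃ f : D.crossings → G.edgeSet,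
    Function.Injective f ∧ ∀ c, (c : ℝ × ℝ) ∈ D.arcIm (f c) := by
  choose f g hfg using fun c : D.crossings => c.2.2
  refine ⟨f, fun c c' h => Subtype.ext ?_, fun c => (hfg c).2.1⟩
  exact hD (f c) ⟨c.2, (hfg c).2.1⟩ ⟨c'.2, h ▸ (hfg c').2.1⟩

/-- Deleting one edge per crossing from a 1-planar drawing leaves a plane graph. -/
theorem card_edges_le_of_isOnePlanar [Fintype V] (hD : D.IsOnePlanar) (hV : 3 ≤ Fintype.card V) :
    G.edgeSet.ncard + 6 ≤ 3 * Fintype.card V + D.crossings.ncard := by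
  classical
  obtain ⟨f, hf, hfc⟩ := D.exists_injective_edge hD
  have : Finite D.crossings := Finite.of_injective f hf
  have := Fintype.ofFinite D.crossings
  choose src tgt hends h0 h1 using D.arc_ends
  let Γ : PlaneGraph V ↥(range f)ᶜ :=
    { pos := fun v => Complex.equivRealProdCLM.symm (D.pos v)
      src := fun e => src e
      tgt := fun e => tgt e
      arc := fun e t => Complex.equivRealProdCLM.symm (D.arc e t)
      pos_inj := Complex.equivRealProdCLM.symm.injective.comp D.pos_inj
      arc_cont := fun e => D.arc_cont_complex e
      arc_inj := fun e => Complex.equivRealProdCLM.symm.injective.comp_injOn (D.arc_inj e)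
      arc_zero := fun e => congrArg _ (h0 e)
      arc_one := fun e => congrArg _ (h1 e)
      arc_ne_pos := fun e t ht v h => D.arc_notMem_range_pos e ht
        ⟨v, (Complex.equivRealProdCLM.symm.injective h).symm⟩
      arc_ne_arc := fun e e' hne t ht t' ht' h => by
        replace h := Complex.equivRealProdCLM.symm.injective h
        have hc := D.mem_crossings_of_arc_eq_arc (fun h => hne (Subtype.ext h)) ht ht' h
        rcases D.at_most_two _ hc.1 e e' (f ⟨_, hc⟩) (D.arc_mem_arcIm e ht)
          (h ▸ D.arc_mem_arcIm e' ht') (hfc ⟨_, hc⟩) with h | h | h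
        · exact hne (Subtype.ext h)
        · exact e.2 ⟨_, h.symm⟩
        · exact e'.2 ⟨_, h.symm⟩ }
  have h := Γ.card_edges_le_of_simple hV fun e e' h => by
    have h : s(src e, tgt e) = s(src e', tgt e') := h
    rw [← hends, ← hends] at h
    exact Subtype.ext (Subtype.ext h)
  have hc : Fintype.card ↥(range f)ᶜ = Fintype.card G.edgeSet - Fintype.card D.crossings := by
    rw [Fintype.card_compl_set, card_range_of_injective hf]
  rw [← Nat.card_coe_set_eq, ← Nat.card_coe_set_eq, Nat.card_eq_fintype_card,
    Nat.card_eq_fintype_card]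
  omega

theorem ncard_cluster {c : ℝ × ℝ} (hc : c ∈ D.crossings) : (D.cluster c).ncard = 4 := by
  obtain ⟨hr, e₁, e₂, hne, h1, h2⟩ := hc
  obtain ⟨x, y, hxy, -, -⟩ := D.arc_ends e₁
  obtain ⟨z, w, hzw, -, -⟩ := D.arc_ends e₂
  have hdis : ∀ v, v ∈ (e₁ : Sym2 V) → v ∉ (e₂ : Sym2 V) := fun v hv hv' =>
    hr ⟨v, (D.shared_endpoint e₁ e₂ hne v hv hv' ⟨h1, h2⟩).symm⟩
  have hcl : D.cluster c = {x, y, z, w} := by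
    ext v
    simp only [cluster, mem_ofPred_eq, mem_insert_iff, mem_singleton_iff]
    constructor
    · rintro ⟨e, he, hv⟩
      rcases D.at_most_two c hr e₁ e₂ e h1 h2 he with h | rfl | rfl
      · exact absurd h hne
      · rw [hxy, Sym2.mem_iff] at hv
        tauto
      · rw [hzw, Sym2.mem_iff] at hv
        tauto
    · rintro (rfl | rfl | rfl | rfl)
      · exact ⟨e₁, h1, by simp [hxy]⟩
      · exact ⟨e₁, h1, by simp [hxy]⟩
      · exact ⟨e₂, h2, by simp [hzw]⟩
      · exact ⟨e₂, h2, by simp [hzw]⟩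
  have hxy' : x ≠ y := (G.mem_edgeSet.1 (hxy ▸ e₁.2)).ne
  have hzw' : z ≠ w := (G.mem_edgeSet.1 (hzw ▸ e₂.2)).ne
  simp only [hxy, hzw, Sym2.mem_iff] at hdis
  rw [hcl, ncard_insert_of_notMem (by grind), ncard_insert_of_notMem (by grind),
    ncard_pair hzw']

theorem exists_half_edge {c : ℝ × ℝ} (hc : c ∈ D.crossings) {v : V} (hv : v ∈ D.cluster c) :
    ∃ (e : G.edgeSet) (t s : ℝ), t ∈ Ioo (0 : ℝ) 1 ∧ D.arc e t = c ∧ (s = 0 ∨ s = 1) ∧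
      D.arc e s = D.pos v := by
  obtain ⟨e, hce, hve⟩ := hv
  obtain ⟨t, ht, hct⟩ := D.exists_mem_Ioo_of_mem_arcIm hce hc.1
  obtain ⟨x, y, hxy, h0, h1⟩ := D.arc_ends e
  rw [hxy, Sym2.mem_iff] at hve
  rcases hve with rfl | rfl
  · exact ⟨e, t, 0, ht, hct, .inl rfl, h0⟩
  · exact ⟨e, t, 1, ht, hct, .inr rfl, h1⟩

/-- The bipartite incidence graph between the crossings of an NIC-planar drawing and the vertices
of their clusters is plane and has no `4`-cycles, which bounds the number of crossings. -/
theorem crossings_ncard_le [Fintype V] (hD : D.IsNICPlanar) (hV : 3 ≤ Fintype.card V) :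
    5 * D.crossings.ncard + 6 ≤ 3 * Fintype.card V := by
  classical
  obtain ⟨f, hf, -⟩ := D.exists_injective_edge hD.1
  have : Finite D.crossings := Finite.of_injective f hf
  have := Fintype.ofFinite D.crossings
  choose e t s ht hct hs hsv using
    fun x : Σ c : D.crossings, D.cluster c => D.exists_half_edge x.1.2 x.2.2
  have hIcc : ∀ x, ∀ u ∈ Icc (0 : ℝ) 1, t x + u * (s x - t x) ∈ Icc (0 : ℝ) 1 := fun x u hu => by
    obtain ⟨h1, h2⟩ := ht x
    obtain ⟨h3, h4⟩ := hu
    rcases hs x with h | h <;> rw [h] <;> constructor <;> nlinarith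
  have hIoo : ∀ x, ∀ u ∈ Ioo (0 : ℝ) 1, t x + u * (s x - t x) ∈ Ioo (0 : ℝ) 1 := fun x u hu => by
    obtain ⟨h1, h2⟩ := ht x
    obtain ⟨h3, h4⟩ := hu
    rcases hs x with h | h <;> rw [h] <;> constructor <;> nlinarith
  have hst : ∀ x, s x - t x ≠ 0 := fun x => by
    obtain ⟨h1, h2⟩ := ht x
    rcases hs x with h | h <;> rw [h]
    · linarith
    · linarith
  have hcross : ∀ x, ∀ u ∈ Ioo (0 : ℝ) 1, D.arc (e x) (t x + u * (s x - t x)) ∉ D.crossings := by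
    intro x u hu hc
    have h : D.arc (e x) (t x + u * (s x - t x)) = x.1 :=
      hD.1 (e x) ⟨hc, D.arc_mem_arcIm _ (hIoo x u hu)⟩
        ⟨x.1.2, hct x ▸ D.arc_mem_arcIm _ (ht x)⟩
    rw [← hct x] at h
    have := D.arc_inj (e x) (hIcc x u (Ioo_subset_Icc_self hu)) (Ioo_subset_Icc_self (ht x)) h
    have h0 : u * (s x - t x) = 0 := by linarith
    exact (mul_ne_zero hu.1.ne' (hst x)) h0
  let Γ : PlaneGraph (V ⊕ D.crossings) (Σ c : D.crossings, D.cluster c) :=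
    { pos := Sum.elim (fun v => Complex.equivRealProdCLM.symm (D.pos v))
        fun c => Complex.equivRealProdCLM.symm c
      src := fun x => .inr x.1
      tgt := fun x => .inl x.2
      arc := fun x u => Complex.equivRealProdCLM.symm (D.arc (e x) (t x + u * (s x - t x)))
      pos_inj := by
        refine Function.Injective.sumElim
          (Complex.equivRealProdCLM.symm.injective.comp D.pos_inj)
          (Complex.equivRealProdCLM.symm.injective.comp Subtype.val_injective) fun v c h => ?_
        exact c.2.1 ⟨v, Complex.equivRealProdCLM.symm.injective h⟩
      arc_cont := fun x => (D.arc_cont_complex (e x)).comp (by fun_prop) (hIcc x)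
      arc_inj := fun x u hu u' hu' h => by
        have h1 := D.arc_inj (e x) (hIcc x u hu) (hIcc x u' hu')
          (Complex.equivRealProdCLM.symm.injective h)
        exact mul_right_cancel₀ (hst x) (add_left_cancel h1)
      arc_zero := fun x => by simp [hct]
      arc_one := fun x => by simp [hsv]
      arc_ne_pos := fun x u hu y h => by
        rcases y with v | c
        · exact D.arc_notMem_range_pos _ (hIoo x u hu)
            ⟨v, (Complex.equivRealProdCLM.symm.injective h).symm⟩
        · have h := Complex.equivRealProdCLM.symm.injective h
          exact hcross x u hu (h ▸ c.2)
      arc_ne_arc := fun x y hxy u hu u' hu' h => by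
        replace h := Complex.equivRealProdCLM.symm.injective h
        by_cases hexy : e x = e y
        · have hcxy : (x.1 : ℝ × ℝ) = y.1 :=
            hD.1 (e x) ⟨x.1.2, hct x ▸ D.arc_mem_arcIm _ (ht x)⟩
              ⟨y.1.2, hexy ▸ hct y ▸ D.arc_mem_arcIm _ (ht y)⟩
          have htxy : t x = t y := D.arc_inj (e x) (Ioo_subset_Icc_self (ht x))
            (Ioo_subset_Icc_self (ht y)) (by rw [hct x, hexy, hct y, hcxy])
          have hsxy : s x ≠ s y := fun hsxy => by
            have hv : (x.2 : V) = y.2 := D.pos_inj (by rw [← hsv, ← hsv, hexy, hsxy])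
            apply hxy
            obtain ⟨c, v⟩ := x
            obtain ⟨c', v'⟩ := y
            obtain rfl : c = c' := Subtype.ext hcxy
            obtain rfl : v = v' := Subtype.ext hv
            rfl
          have h1 := D.arc_inj (e x) (hIcc x u (Ioo_subset_Icc_self hu))
            (hIcc y u' (Ioo_subset_Icc_self hu')) (by rw [h, hexy])
          rw [← htxy] at h1
          have h2 := add_left_cancel h1
          obtain ⟨h3, h4⟩ := ht x
          obtain ⟨h5, -⟩ := hu
          obtain ⟨h6, -⟩ := hu'
          rcases hs x with hx | hx <;> rcases hs y with hy | hy <;> rw [hx, hy] at h2 hsxy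
          · exact hsxy rfl
          · nlinarith [mul_pos h5 h3, mul_pos h6 (sub_pos.2 h4)]
          · nlinarith [mul_pos h6 h3, mul_pos h5 (sub_pos.2 h4)]
          · exact hsxy rfl
        · exact hcross x u hu
            (D.mem_crossings_of_arc_eq_arc hexy (hIoo x u hu) (hIoo y u' hu') h) }
  have : Nonempty V := Fintype.card_pos_iff.1 (by omega)
  have h := Γ.card_edges_le_of_linear (c := fun x => x.1) (w := fun x => (x.2 : V))
    (fun _ => rfl) (fun _ => rfl) ?_ ?_
  · have hE : Fintype.card (Σ c : D.crossings, D.cluster c) = 4 * Fintype.card D.crossings := by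
      have hcl : ∀ c : D.crossings, Fintype.card (D.cluster c) = 4 := fun c => by
        rw [← D.ncard_cluster c.2, ← Nat.card_coe_set_eq, Nat.card_eq_fintype_card]
      simp [hcl, mul_comm]
    have h4 : Fintype.card D.crossings ≠ 0 → 4 ≤ Fintype.card V := fun hne => by
      obtain ⟨c⟩ := Fintype.card_pos_iff.1 (Nat.pos_of_ne_zero hne)
      rw [← D.ncard_cluster c.2, ← Nat.card_eq_fintype_card]
      exact ncard_le_card _
    rw [← Nat.card_coe_set_eq, Nat.card_eq_fintype_card]
    omega
  · rintro ⟨c, v⟩ ⟨c', v'⟩ h1 h2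
    obtain rfl : c = c' := h1
    obtain rfl : v = v' := Subtype.ext h2
    rfl
  · rintro ⟨c₁, v₁⟩ ⟨c₂, v₂⟩ ⟨c₃, v₃⟩ ⟨c₄, v₄⟩ h1 h2 h3 h4 h5
    obtain rfl : c₁ = c₂ := h1
    obtain rfl : c₃ = c₄ := h2
    by_contra hne
    have h := hD.2 c₁ c₁.2 c₃ c₃.2 fun h => hne (Subtype.ext h)
    rw [ncard_le_one_iff] at h
    have h3 : (v₁ : V) = v₃ := h3
    have h4 : (v₂ : V) = v₄ := h4
    exact h5 (h ⟨v₁.2, h3 ▸ v₃.2⟩ ⟨v₂.2, h4 ▸ v₄.2⟩)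

end Drawing

/-- every NIC-planar graph `G` with at least three vertices satisfies
`5 · e(G) ≤ 18 · (v(G) − 2)`. -/
theorem stmt2 {V : Type*} [Fintype V] (G : SimpleGraph V)
    (hG : G.NICPlanar) (hV : 3 ≤ Fintype.card V) :
    5 * G.edgeSet.ncard ≤ 18 * (Fintype.card V - 2) := by
  obtain ⟨D, hD⟩ := hG
  have h1 := D.card_edges_le_of_isOnePlanar hD.1 hV
  have h2 := D.crossings_ncard_le hD hV
  omega
end

section
/- Every NIC-planar graph with at least one vertex contains a vertex of degree at most 6. -/
open Set

/-- A nonvanishing continuous function on the plane has a continuous logarithm. -/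
theorem exists_continuous_log {F : ℝ × ℝ → ℂ} (hF : Continuous F) (h0 : ∀ x, F x ≠ 0) :
    ∃ L : ℝ × ℝ → ℂ, Continuous L ∧ ∀ x, Complex.exp (L x) = F x := by
  obtain ⟨L, ⟨-, hL⟩, -⟩ := Complex.isCoveringMapOn_exp.existsUnique_continuousMap_lifts
    (⟨F, hF⟩ : C(ℝ × ℝ, ℂ)) (a₀ := 0) (e₀ := Complex.log (F 0)) (Complex.exp_log (h0 0))
    (fun x => h0 x)
  exact ⟨L, L.continuous, fun x => congrFun hL x⟩

/-- Continuous logarithms of proportional functions have the same increments. -/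
theorem log_increment_unique {f g : ℝ → ℂ} (hf : Continuous f) (hg : Continuous g) (c : ℂ)
    (h : ∀ s, Complex.exp (f s) = c * Complex.exp (g s)) : f 1 - f 0 = g 1 - g 0 := by
  have hc : c = Complex.exp (f 0 - g 0) := by
    rw [Complex.exp_sub, h 0, mul_div_cancel_right₀ _ (Complex.exp_ne_zero _)]
  have := Complex.isCoveringMap_exp.eq_of_comp_eq (g₁ := f) (g₂ := fun s => g s + (f 0 - g 0))
    hf (by fun_prop) (by
      funext s
      refine Subtype.ext ?_
      simp only [Function.comp_apply]
      rw [h s, hc, Complex.exp_add, mul_comm]) 0 (by ring)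
  have h1 := congrFun this 1
  rw [h1]; ring

theorem no_five_paths (p : Fin 5 → ℂ) (γ : Fin 5 → Fin 5 → ℝ → ℂ)
    (hc : ∀ i j, i < j → Continuous (γ i j))
    (h0 : ∀ i j, i < j → γ i j 0 = p i) (h1 : ∀ i j, i < j → γ i j 1 = p j)
    (hd : ∀ i j k l, i < j → k < l → i ≠ k → i ≠ l → j ≠ k → j ≠ l →
      ∀ s t, γ i j s ≠ γ k l t) : False := by
  have hp : ∀ i j k, i < j → k ≠ i → k ≠ j → ∀ s, γ i j s ≠ p k := by
    intro i j k hij hki hkj s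
    obtain ⟨l, hl⟩ : ∃ l : Fin 5, l ≠ i ∧ l ≠ j ∧ l ≠ k := by
      clear hki hkj hij; revert i j k; decide
    rcases lt_or_gt_of_ne hl.2.2 with hlk | hlk
    · rw [← h1 l k hlk]
      exact hd i j l k hij hlk hl.1.symm hki.symm hl.2.1.symm hkj.symm s 1
    · rw [← h0 k l hlk]
      exact hd i j k l hij hlk hki.symm hl.1.symm hkj.symm hl.2.1.symm s 0
  have hpp : ∀ i j, i ≠ j → p i ≠ p j := by
    intro i j hij
    obtain ⟨l, hl⟩ : ∃ l : Fin 5, l ≠ i ∧ l ≠ j := by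
      clear hij; revert i j; decide
    rcases lt_or_gt_of_ne hl.1 with h | h
    · rw [← h1 l i h]
      exact hp l i j h hl.2.symm hij.symm 1
    · rw [← h0 i l h]
      exact hp i l j h hij.symm hl.2.symm 0
  -- logarithms of the differences of the vertices
  obtain ⟨a, ha, haa⟩ : ∃ a : Fin 5 → Fin 5 → ℂ,
      (∀ i j, i ≠ j → Complex.exp (a i j) = p j - p i) ∧
      ∀ i j, i < j → a j i = a i j + Real.pi * Complex.I := by
    refine ⟨fun i j => if i < j then Complex.log (p j - p i) else
      Complex.log (p i - p j) + Real.pi * Complex.I, ?_, ?_⟩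
    · intro i j hij
      rcases lt_or_gt_of_ne hij with h | h
      · simp only [h, if_true]
        exact Complex.exp_log (sub_ne_zero.2 (hpp j i hij.symm))
      · simp only [h.not_gt, if_false]
        rw [Complex.exp_add, Complex.exp_pi_mul_I,
          Complex.exp_log (sub_ne_zero.2 (hpp i j hij))]
        ring
    · intro i j h
      simp [h, h.not_gt]
  have hL : ∀ i j k, ∃ L : ℝ → ℂ, i < j → k ≠ i → k ≠ j → Continuous L ∧
      ∀ s, Complex.exp (L s) = γ i j s - p k := by
    intro i j k
    by_cases h : i < j ∧ k ≠ i ∧ k ≠ j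
    · obtain ⟨hij, hki, hkj⟩ := h
      have := hc i j hij
      obtain ⟨L, hL, hLe⟩ := exists_continuous_log (F := fun x => γ i j x.1 - p k)
        (by fun_prop) (fun x => sub_ne_zero.2 (hp i j k hij hki hkj x.1))
      exact ⟨fun s => L (s, 0), fun _ _ _ => ⟨by fun_prop, fun s => hLe (s, 0)⟩⟩
    · exact ⟨0, fun h1 h2 h3 => absurd ⟨h1, h2, h3⟩ h⟩
  choose L hL using hL
  have hn : ∀ i j k, ∃ n : ℤ, i < j → k ≠ i → k ≠ j →
      L i j k 1 - L i j k 0 = a k j - a k i + n * (2 * Real.pi * Complex.I) := by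
    intro i j k
    by_cases h : i < j ∧ k ≠ i ∧ k ≠ j
    · obtain ⟨hij, hki, hkj⟩ := h
      obtain ⟨-, hLe⟩ := hL i j k hij hki hkj
      have : Complex.exp (L i j k 1 - L i j k 0) = Complex.exp (a k j - a k i) := by
        rw [Complex.exp_sub, Complex.exp_sub, hLe, hLe, ha _ _ hki, ha _ _ hkj, h0 _ _ hij,
          h1 _ _ hij]
      obtain ⟨n, hn⟩ := Complex.exp_eq_exp_iff_exists_int.1 this
      exact ⟨n, fun _ _ _ => hn⟩
    · exact ⟨0, fun h1 h2 h3 => absurd ⟨h1, h2, h3⟩ h⟩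
  choose n hn using hn
  have key : ∀ i j k l, i < j → k < l → i ≠ k → i ≠ l → j ≠ k → j ≠ l →
      (L i j k 1 - L i j k 0) - (L i j l 1 - L i j l 0)
        + (L k l j 1 - L k l j 0) - (L k l i 1 - L k l i 0) = 0 := by
    intro i j k l hij hkl hik hil hjk hjl
    have c1 := hc i j hij
    have c2 := hc k l hkl
    obtain ⟨M, hM, hMe⟩ := exists_continuous_log (F := fun x => γ i j x.1 - γ k l x.2)
        (by fun_prop) (fun x => sub_ne_zero.2 (hd i j k l hij hkl hik hil hjk hjl x.1 x.2))
    have e1 := log_increment_unique (hL i j k hij hik.symm hjk.symm).1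
      (g := fun s => M (s, 0)) (by fun_prop) 1 (by
        intro s; rw [(hL i j k hij hik.symm hjk.symm).2, hMe]; simp [h0 k l hkl])
    have e2 := log_increment_unique (hL i j l hij hil.symm hjl.symm).1
      (g := fun s => M (s, 1)) (by fun_prop) 1 (by
        intro s; rw [(hL i j l hij hil.symm hjl.symm).2, hMe]; simp [h1 k l hkl])
    have e3 := log_increment_unique (hL k l j hkl hjk hjl).1
      (g := fun s => M (1, s)) (by fun_prop) (-1) (by
        intro s; rw [(hL k l j hkl hjk hjl).2, hMe]; simp [h1 i j hij])
    have e4 := log_increment_unique (hL k l i hkl hik hil).1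
      (g := fun s => M (0, s)) (by fun_prop) (-1) (by
        intro s; rw [(hL k l i hkl hik hil).2, hMe]; simp [h0 i j hij])
    rw [e1, e2, e3, e4]; ring
  -- the integral form of the relation on every product of disjoint edges
  have key2 : ∀ i j k l, i < j → k < l → i < k → i ≠ l → j ≠ k → j ≠ l →
      2 * (n i j k - n i j l + n k l j - n k l i) =
        if j < k then 0 else if j < l then 2 else 0 := by
    intro i j k l hij hkl hik hil hjk hjl
    have K := key i j k l hij hkl hik.ne hil hjk hjl
    rw [hn i j k hij hik.ne' hjk.symm, hn i j l hij hil.symm hjl.symm, hn k l j hkl hjk hjl,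
      hn k l i hkl hik.ne hil] at K
    rw [haa i k hik, haa i l (hik.trans hkl)] at K
    have hpi : (Real.pi : ℂ) * Complex.I ≠ 0 := by
      simp [Real.pi_ne_zero]
    have : ((2 * (n i j k - n i j l + n k l j - n k l i) : ℤ) : ℂ) =
        ((if j < k then 0 else if j < l then 2 else 0 : ℤ) : ℂ) := by
      apply mul_right_cancel₀ hpi
      rcases lt_or_gt_of_ne hjk with h | h
      · rw [haa j k h, haa j l (h.trans hkl)] at K
        simp only [h, if_true]
        push_cast
        linear_combination K
      · rcases lt_or_gt_of_ne hjl with h' | h'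
        · rw [haa k j h, haa j l h'] at K
          simp only [h.not_gt, h', if_true, if_false]
          push_cast
          linear_combination K
        · rw [haa k j h, haa l j h'] at K
          simp only [h.not_gt, h'.not_gt, if_false]
          push_cast
          linear_combination K
    exact_mod_cast this
  have q := fun i j k l (h : i < j ∧ k < l ∧ i < k ∧ i ≠ l ∧ j ≠ k ∧ j ≠ l) =>
    key2 i j k l h.1 h.2.1 h.2.2.1 h.2.2.2.1 h.2.2.2.2.1 h.2.2.2.2.2
  have q1 := q 0 1 2 3 (by decide)
  have q2 := q 0 1 2 4 (by decide)
  have q3 := q 0 1 3 4 (by decide)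
  have q4 := q 0 2 1 3 (by decide)
  have q5 := q 0 2 1 4 (by decide)
  have q6 := q 0 2 3 4 (by decide)
  have q7 := q 0 3 1 2 (by decide)
  have q8 := q 0 3 1 4 (by decide)
  have q9 := q 0 3 2 4 (by decide)
  have q10 := q 0 4 1 2 (by decide)
  have q11 := q 0 4 1 3 (by decide)
  have q12 := q 0 4 2 3 (by decide)
  have q13 := q 1 2 3 4 (by decide)
  have q14 := q 1 3 2 4 (by decide)
  have q15 := q 1 4 2 3 (by decide)
  clear q key2 key hn hL haa ha hpp hp
  simp +decide only [if_true, if_false] at q1 q2 q3 q4 q5 q6 q7 q8 q9 q10 q11 q12 q13 q14 q15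
  omega

/-- A graph is *weakly planar* if it can be mapped to the plane so that the images of any two
edges without a common endpoint are disjoint. -/
def WeaklyPlanar {W : Type*} (H : SimpleGraph W) : Prop :=
  ∃ (p : W → ℝ × ℝ) (S : W → W → Set (ℝ × ℝ)),
    (∀ u v, H.Adj u v → JoinedIn (S u v) (p u) (p v)) ∧
    ∀ u v w z, H.Adj u v → H.Adj w z → u ≠ w → u ≠ z → v ≠ w → v ≠ z →
      Disjoint (S u v) (S w z)

/-- The graph obtained from `H` by moving all neighbours of `v` over to `u`; the vertex `v`
stays behind as an isolated vertex. -/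
def contractInto {W : Type*} (H : SimpleGraph W) (u v : W) : SimpleGraph W where
  Adj x y := x ≠ y ∧ x ≠ v ∧ y ≠ v ∧ (H.Adj x y ∨ (x = u ∧ H.Adj v y) ∨ (y = u ∧ H.Adj x v))
  symm := ⟨by
    rintro x y ⟨h1, h2, h3, h4⟩
    refine ⟨h1.symm, h3, h2, ?_⟩
    rcases h4 with h | ⟨h, h'⟩ | ⟨h, h'⟩
    · exact Or.inl h.symm
    · exact Or.inr (Or.inr ⟨h, h'.symm⟩)
    · exact Or.inr (Or.inl ⟨h, h'.symm⟩)⟩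
  loopless := ⟨fun x h => h.1 rfl⟩

namespace WeaklyPlanar

variable {W : Type*} {H : SimpleGraph W}

theorem mono {H' : SimpleGraph W} (hH : WeaklyPlanar H) (hle : H' ≤ H) : WeaklyPlanar H' := by
  obtain ⟨p, S, h1, h2⟩ := hH
  exact ⟨p, S, fun u v h => h1 u v (hle h), fun u v w z h h' => h2 u v w z (hle h) (hle h')⟩

theorem contract (hH : WeaklyPlanar H) {u v : W} (huv : H.Adj u v) :
    WeaklyPlanar (contractInto H u v) := by
  classical
  obtain ⟨p, S, h1, h2⟩ := hH
  have hvu := huv.symm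
  have two : ∀ {x y z}, H.Adj x y → H.Adj y z → JoinedIn (S x y ∪ S y z) (p x) (p z) :=
    fun h h' => ((h1 _ _ h).mono subset_union_left).trans ((h1 _ _ h').mono subset_union_right)
  refine ⟨p, fun x y => if H.Adj x y then S x y else
    if x = u then S u v ∪ S v y else S x v ∪ S v u, ?_, ?_⟩
  · rintro x y ⟨hxy, hx, hy, h⟩
    by_cases hadj : H.Adj x y
    · simpa only [hadj, if_true] using h1 x y hadj
    · simp only [hadj, if_false]
      by_cases hxu : x = u
      · subst hxu
        simp only [if_true]
        rcases h with h | ⟨-, h⟩ | ⟨h, -⟩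
        · exact absurd h hadj
        · exact two huv h
        · exact absurd h.symm hxy
      · simp only [hxu, if_false]
        rcases h with h | ⟨h, -⟩ | ⟨rfl, h⟩
        · exact absurd h hadj
        · exact absurd h hxu
        · exact two h hvu
  · have mixed : ∀ x y w z, (contractInto H u v).Adj x y → ¬ H.Adj x y → H.Adj w z →
        w ≠ v → z ≠ v → x ≠ w → x ≠ z → y ≠ w → y ≠ z →
        Disjoint (if x = u then S u v ∪ S v y else S x v ∪ S v u) (S w z) := by
      rintro x y w z ⟨hxy, hx, hy, h⟩ hadj hwz hw hz a b c d
      by_cases hxu : x = u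
      · subst hxu
        simp only [if_true, disjoint_union_left]
        rcases h with h | ⟨-, h⟩ | ⟨h, -⟩
        · exact absurd h hadj
        · exact ⟨h2 _ _ _ _ huv hwz a b hw.symm hz.symm,
            h2 _ _ _ _ h hwz hw.symm hz.symm c d⟩
        · exact absurd h.symm hxy
      · simp only [hxu, if_false, disjoint_union_left]
        rcases h with h | ⟨h, -⟩ | ⟨rfl, h⟩
        · exact absurd h hadj
        · exact absurd h hxu
        · exact ⟨h2 _ _ _ _ h hwz a b hw.symm hz.symm,
            h2 _ _ _ _ hvu hwz hw.symm hz.symm c d⟩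
    intro x y w z hxy hwz a b c d
    by_cases e1 : H.Adj x y <;> by_cases e2 : H.Adj w z
    · simp only [e1, e2, if_true]
      exact h2 x y w z e1 e2 a b c d
    · simp only [e1, e2, if_true, if_false]
      exact (mixed w z x y hwz e2 e1 hxy.2.1 hxy.2.2.1 a.symm c.symm b.symm d.symm).symm
    · simp only [e1, e2, if_true, if_false]
      exact mixed x y w z hxy e1 e2 hwz.2.1 hwz.2.2.1 a b c d
    · exfalso
      obtain ⟨-, -, -, h⟩ := hxy
      obtain ⟨-, -, -, h'⟩ := hwz
      rcases h with h | ⟨rfl, -⟩ | ⟨rfl, -⟩ <;> rcases h' with h' | ⟨rfl, -⟩ | ⟨rfl, -⟩ <;>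
        first | exact e1 h | exact e2 h' | exact a rfl | exact b rfl | exact c rfl | exact d rfl

theorem cliqueFree_five (hH : WeaklyPlanar H) : H.CliqueFree 5 := by
  by_contra hK
  obtain ⟨f⟩ := (SimpleGraph.not_cliqueFree_iff_top_isContained 5).1 hK
  obtain ⟨p, S, h1, h2⟩ := hH
  have hadj : ∀ i j : Fin 5, i < j → H.Adj (f i) (f j) := fun i j hij => f.toHom.map_adj hij.ne
  choose! γ hγ using fun (i j : Fin 5) (hij : i < j) =>
    (show ∃ g : ℝ → ℝ × ℝ, Continuous g ∧ g 0 = p (f i) ∧ g 1 = p (f j) ∧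
      ∀ t, g t ∈ S (f i) (f j) from by
    obtain ⟨q, hq⟩ := h1 _ _ (hadj i j hij)
    exact ⟨q.extend, q.continuous_extend, q.extend_zero, q.extend_one, fun t => hq _⟩)
  set φ := Complex.equivRealProdCLM.symm
  refine no_five_paths (fun i => φ (p (f i))) (fun i j t => φ (γ i j t))
    (fun i j h => φ.continuous.comp (hγ i j h).1)
    (fun i j h => by rw [(hγ i j h).2.1]) (fun i j h => by rw [(hγ i j h).2.2.1]) ?_
  intro i j k l hij hkl a b c d s t hst
  have := φ.injective hst
  exact Set.disjoint_left.1 (h2 _ _ _ _ (hadj i j hij) (hadj k l hkl) (f.injective.ne a)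
    (f.injective.ne b) (f.injective.ne c) (f.injective.ne d)) ((hγ i j hij).2.2.2 s)
    (this ▸ (hγ k l hkl).2.2.2 t)

end WeaklyPlanar

open scoped Classical in
theorem le_card_edgeFinset_contractInto {W : Type*} [Fintype W] {H : SimpleGraph W} {u v : W}
    (huv : H.Adj u v) :
    H.edgeFinset.card ≤ (contractInto H u v).edgeFinset.card + 1 +
      (H.neighborFinset v ∩ H.neighborFinset u).card := by
  have hle := Finset.card_le_card (H.incidenceFinset_subset v)
  rw [H.card_incidenceFinset_eq_degree] at hle
  have hdel := H.card_edgeFinset_deleteIncidenceSet v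
  set N := (H.neighborFinset v \ H.neighborFinset u).erase u with hN
  have hNc : H.degree v = N.card + 1 + (H.neighborFinset v ∩ H.neighborFinset u).card := by
    have hu : u ∈ H.neighborFinset v \ H.neighborFinset u := by simp [huv.symm]
    have := Finset.card_erase_add_one hu
    rw [hN, this, Finset.card_sdiff_add_card_inter, H.card_neighborFinset_eq_degree]
  have himg : (N.image fun y => s(u, y)).card = N.card :=
    Finset.card_image_of_injective _ fun x y h => Sym2.congr_right.1 h
  have hsub : (H.deleteIncidenceSet v).edgeFinset ∪ N.image (fun y => s(u, y)) ⊆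
      (contractInto H u v).edgeFinset := by
    intro e
    induction e with | _ x y
    simp only [Finset.mem_union, SimpleGraph.mem_edgeFinset, SimpleGraph.mem_edgeSet,
      SimpleGraph.deleteIncidenceSet_adj, Finset.mem_image]
    rintro (⟨h, hx, hy⟩ | ⟨z, hz, hzz⟩)
    · exact ⟨h.ne, hx, hy, Or.inl h⟩
    · rw [← SimpleGraph.mem_edgeSet, ← hzz, SimpleGraph.mem_edgeSet]
      simp only [hN, Finset.mem_erase, Finset.mem_sdiff, SimpleGraph.mem_neighborFinset] at hz
      exact ⟨hz.1.symm, huv.ne, hz.2.1.ne', Or.inr (Or.inl ⟨rfl, hz.2.1⟩)⟩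
  have hdisj : Disjoint (H.deleteIncidenceSet v).edgeFinset (N.image fun y => s(u, y)) := by
    rw [Finset.disjoint_left]
    intro e he he'
    obtain ⟨y, hy, rfl⟩ := Finset.mem_image.1 he'
    simp only [SimpleGraph.mem_edgeFinset, SimpleGraph.mem_edgeSet,
      SimpleGraph.deleteIncidenceSet_adj] at he
    simp only [hN, Finset.mem_erase, Finset.mem_sdiff, SimpleGraph.mem_neighborFinset] at hy
    exact hy.2.2 he.1
  have := Finset.card_le_card hsub
  rw [Finset.card_union_of_disjoint hdisj, himg] at this
  omega

open scoped Classical in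
/-- A vertex of degree `4` or `5` all of whose edges lie in three triangles yields a `K₅`-minor. -/
theorem WeaklyPlanar.exists_card_inter_lt {W : Type*} [Fintype W] {H : SimpleGraph W}
    (hH : WeaklyPlanar H) {v : W} (h4 : 4 ≤ H.degree v) (h5 : H.degree v ≤ 5) :
    ∃ x, H.Adj v x ∧ (H.neighborFinset v ∩ H.neighborFinset x).card < 3 := by
  by_contra! hcon
  set N := H.neighborFinset v with hN
  have hNv : ∀ x, x ∈ N ↔ H.Adj v x := fun x => by simp [hN]
  have hNc : N.card = H.degree v := H.card_neighborFinset_eq_degree v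
  by_cases hcl : (H.IsClique (N : Set W))
  · have : H.IsNClique (N.card + 1) (insert v N) :=
      SimpleGraph.IsNClique.insert ⟨hcl, rfl⟩ fun b hb => (hNv b).1 hb
    exact (hH.cliqueFree_five.mono (by omega)) _ this
  simp only [SimpleGraph.IsClique, Set.Pairwise, Finset.mem_coe] at hcl
  push Not at hcl
  obtain ⟨x, hx, y, hy, hxy, hnxy⟩ := hcl
  have full : ∀ a b, a ∈ N → b ∈ N → a ≠ b → ¬ H.Adj a b → N.card = 5 ∧
      ∀ r ∈ N, r ≠ a → r ≠ b → H.Adj a r := by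
    intro a b ha hb hab hnab
    have hsub : N ∩ H.neighborFinset a ⊆ (N.erase a).erase b := by
      intro r hr
      simp only [Finset.mem_inter, SimpleGraph.mem_neighborFinset] at hr
      simp only [Finset.mem_erase]
      exact ⟨fun h => hnab (h ▸ hr.2), hr.2.ne', hr.1⟩
    have hc := Finset.card_le_card hsub
    have h3 := hcon a ((hNv a).1 ha)
    rw [Finset.card_erase_of_mem (Finset.mem_erase.2 ⟨hab.symm, hb⟩),
      Finset.card_erase_of_mem ha] at hc
    refine ⟨by omega, fun r hr hra hrb => ?_⟩
    have heq := Finset.eq_of_subset_of_card_le hsub (by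
      rw [Finset.card_erase_of_mem (Finset.mem_erase.2 ⟨hab.symm, hb⟩),
      Finset.card_erase_of_mem ha]; omega)
    have : r ∈ N ∩ H.neighborFinset a := heq ▸ by simp [hr, hra, hrb]
    simpa using (Finset.mem_inter.1 this).2
  obtain ⟨hN5, hxa⟩ := full x y hx hy hxy hnxy
  obtain ⟨-, hya⟩ := full y x hy hx hxy.symm fun h => hnxy h.symm
  set R := (N.erase x).erase y with hR
  have hRc : R.card = 3 := by
    rw [hR, Finset.card_erase_of_mem (Finset.mem_erase.2 ⟨hxy.symm, hy⟩),
      Finset.card_erase_of_mem hx, hN5]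
  have hRm : ∀ r, r ∈ R ↔ r ≠ y ∧ r ≠ x ∧ r ∈ N := fun r => by simp [hR]
  by_cases hcl : (H.IsClique (R : Set W))
  · have h1 : H.IsNClique 4 (insert x R) :=
      SimpleGraph.IsNClique.insert ⟨hcl, hRc⟩ fun b hb => by
        obtain ⟨h1, h2, h3⟩ := (hRm b).1 hb
        exact hxa b h3 h2 h1
    have h2 : H.IsNClique 5 (insert v (insert x R)) :=
      h1.insert fun b hb => by
        rcases Finset.mem_insert.1 hb with rfl | hb
        · exact (hNv _).1 hx
        · exact (hNv b).1 ((hRm b).1 hb).2.2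
    exact hH.cliqueFree_five _ h2
  simp only [SimpleGraph.IsClique, Set.Pairwise, Finset.mem_coe] at hcl
  push Not at hcl
  obtain ⟨z, hzR, w, hwR, hzw, hnzw⟩ := hcl
  obtain ⟨t, htR⟩ : ((R.erase z).erase w).Nonempty := by
    rw [← Finset.card_pos, Finset.card_erase_of_mem (Finset.mem_erase.2 ⟨hzw.symm, hwR⟩),
      Finset.card_erase_of_mem hzR]
    omega
  simp only [Finset.mem_erase] at htR
  obtain ⟨htw, htz, htR⟩ := htR
  obtain ⟨hzy, hzx, hz⟩ := (hRm z).1 hzR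
  obtain ⟨hwy, hwx, hw⟩ := (hRm w).1 hwR
  obtain ⟨hty, htx, ht⟩ := (hRm t).1 htR
  obtain ⟨-, hwa⟩ := full w z hw hz hzw.symm fun h => hnzw h.symm
  have hvz := ((hNv z).1 hz).ne
  have hC := (hH.contract (hxa z hz hzx hzy)).cliqueFree_five
  have keep : ∀ a b, a ≠ z → b ≠ z → H.Adj a b → (contractInto H x z).Adj a b :=
    fun a b ha hb h => ⟨h.ne, ha, hb, Or.inl h⟩
  have hxyC : (contractInto H x z).Adj x y :=
    ⟨hxy, hzx.symm, hzy.symm, Or.inr (Or.inl ⟨rfl, (hya z hz hzy hzx).symm⟩)⟩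
  have k1 : (contractInto H x z).IsNClique 1 {y} := by simp
  have k2 : (contractInto H x z).IsNClique 2 {x, y} := k1.insert (by simpa using hxyC)
  have k3 : (contractInto H x z).IsNClique 3 {w, x, y} := k2.insert (by
    simp only [Finset.mem_insert, Finset.mem_singleton]
    rintro b (rfl | rfl)
    · exact keep _ _ hzw.symm hzx.symm (hxa w hw hwx hwy).symm
    · exact keep _ _ hzw.symm hzy.symm (hya w hw hwy hwx).symm)
  have k4 : (contractInto H x z).IsNClique 4 {t, w, x, y} := k3.insert (by
    simp only [Finset.mem_insert, Finset.mem_singleton]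
    rintro b (rfl | rfl | rfl)
    · exact keep _ _ htz hzw.symm (hwa t ht htw htz).symm
    · exact keep _ _ htz hzx.symm (hxa t ht htx hty).symm
    · exact keep _ _ htz hzy.symm (hya t ht hty htx).symm)
  have k5 : (contractInto H x z).IsNClique 5 {v, t, w, x, y} := k4.insert (by
    simp only [Finset.mem_insert, Finset.mem_singleton]
    rintro b (rfl | rfl | rfl | rfl)
    · exact keep _ _ hvz htz ((hNv _).1 ht)
    · exact keep _ _ hvz hzw.symm ((hNv _).1 hw)
    · exact keep _ _ hvz hzx.symm ((hNv _).1 hx)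
    · exact keep _ _ hvz hzy.symm ((hNv _).1 hy))
  exact hC _ k5

open scoped Classical in
theorem WeaklyPlanar.card_edgeFinset_add_one_lt {W : Type*} [Fintype W] {H : SimpleGraph W}
    (hH : WeaklyPlanar H) {U : Finset W} (hU : U.Nonempty) (hs : ∀ u v, H.Adj u v → u ∈ U) :
    H.edgeFinset.card + 1 < 3 * U.card := by
  induction hm : U.card using Nat.strong_induction_on generalizing U H with
  | _ m ih
  subst hm
  by_contra! hlt
  have hpos : 0 < U.card := hU.card_pos
  obtain ⟨T, hT, hTc⟩ := Finset.exists_subset_card_eq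
    (show 3 * U.card - 1 ≤ H.edgeFinset.card by omega)
  obtain ⟨H', hle, hH'⟩ : ∃ H' ≤ H, H'.edgeFinset.card = 3 * U.card - 1 := by
    refine ⟨SimpleGraph.fromEdgeSet (T : Set (Sym2 W)), ?_, ?_⟩
    · rw [SimpleGraph.fromEdgeSet_le]
      exact fun e he => SimpleGraph.mem_edgeFinset.1 (hT he.1)
    · rw [← hTc]
      congr 1
      ext e
      refine (@Set.mem_toFinset _ _ (_) _).trans ?_
      rw [SimpleGraph.edgeSet_fromEdgeSet]
      refine ⟨fun h => h.1, fun h => ⟨h, ?_⟩⟩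
      exact H.not_isDiag_of_mem_edgeSet (SimpleGraph.mem_edgeFinset.1 (hT h))
  replace hH := hH.mono hle
  replace hs := fun u v h => hs u v (hle h)
  clear hT hTc hlt hle T H
  rename' H' => H
  obtain ⟨e, he⟩ : H.edgeFinset.Nonempty := by rw [← Finset.card_pos]; omega
  obtain ⟨v, hvU, hv⟩ : ∃ v ∈ U, H.degree v ≤ 5 := by
    by_contra! hcon
    have h1 : U.card • 6 ≤ ∑ v ∈ U, H.degree v := Finset.card_nsmul_le_sum _ _ _ hcon
    have h2 : ∑ v ∈ U, H.degree v ≤ ∑ v, H.degree v :=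
      Finset.sum_le_sum_of_subset (Finset.subset_univ _)
    rw [H.sum_degrees_eq_twice_card_edges] at h2
    simp only [smul_eq_mul] at h1
    omega
  have hcard : (U.erase v).card + 1 = U.card := Finset.card_erase_add_one hvU
  have hne : (U.erase v).Nonempty := by
    induction e with | _ a b
    have hab : H.Adj a b := by simpa using he
    by_cases h : a = v
    · exact ⟨b, Finset.mem_erase.2 ⟨h ▸ hab.ne', hs _ _ hab.symm⟩⟩
    · exact ⟨a, Finset.mem_erase.2 ⟨h, hs _ _ hab⟩⟩
  rcases Nat.lt_or_ge (H.degree v) 4 with h4 | h4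
  · have hdel := H.card_edgeFinset_deleteIncidenceSet v
    have hle := Finset.card_le_card (H.incidenceFinset_subset v)
    rw [H.card_incidenceFinset_eq_degree] at hle
    have := ih (U.erase v).card (by omega)
      (hH.mono (H.deleteIncidenceSet_le v)) hne (fun u w h => by
        rw [SimpleGraph.deleteIncidenceSet_adj] at h
        exact Finset.mem_erase.2 ⟨h.2.1, hs _ _ h.1⟩) rfl
    have hinst : ∀ i₁ i₂ : Fintype (H.deleteIncidenceSet v).edgeSet,
        (@SimpleGraph.edgeFinset _ _ i₁).card = (@SimpleGraph.edgeFinset _ _ i₂).card :=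
      fun _ _ => by congr!
    rw [(hinst _ _).trans hdel] at this
    omega
  · obtain ⟨x, hvx, hx⟩ := hH.exists_card_inter_lt h4 hv
    have hle := le_card_edgeFinset_contractInto hvx.symm
    have := ih (U.erase v).card (by omega)
      (hH.contract hvx.symm) hne (fun u w h => by
        refine Finset.mem_erase.2 ⟨h.2.1, ?_⟩
        rcases h.2.2.2 with h | ⟨rfl, -⟩ | ⟨-, h⟩
        · exact hs _ _ h
        · exact hs _ _ hvx.symm
        · exact hs _ _ h) rfl
    omega

open scoped Classical in
/-- If every vertex has degree at least `7`, then `X.card` quadruples of vertices, any two of them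
sharing at most one vertex, each carrying two disjoint edges `ac` and `bd`, and each being a clique
unless `a` and `b` are not adjacent, are outnumbered by the edges. -/
theorem three_mul_card_add_card_le {V ι : Type*} [Fintype V] (G : SimpleGraph V) (X : Finset ι)
    (a b c d : ι → V) (hac : ∀ x ∈ X, G.Adj (a x) (c x)) (hbd : ∀ x ∈ X, G.Adj (b x) (d x))
    (hab : ∀ x ∈ X, a x ≠ b x) (had : ∀ x ∈ X, a x ≠ d x) (hcb : ∀ x ∈ X, c x ≠ b x)
    (hcd : ∀ x ∈ X, c x ≠ d x)
    (hnic : ∀ x ∈ X, ∀ y ∈ X, x ≠ y →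
      (({a x, b x, c x, d x} : Finset V) ∩ {a y, b y, c y, d y}).card ≤ 1)
    (hcomp : ∀ x ∈ X, (∀ u ∈ ({a x, b x, c x, d x} : Finset V),
      ∀ w ∈ ({a x, b x, c x, d x} : Finset V), u ≠ w → G.Adj u w) ∨ ¬ G.Adj (a x) (b x))
    (hdeg : ∀ v, 7 ≤ G.degree v) :
    3 * Fintype.card V + X.card ≤
      G.edgeFinset.card + (X.filter fun x => ¬ G.Adj (a x) (b x)).card := by
  set K : ι → Finset V := fun x => {a x, b x, c x, d x} with hK
  have hK4 : ∀ x ∈ X, (K x).card = 4 := by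
    intro x hx
    rw [hK]
    simp only
    rw [Finset.card_insert_of_notMem, Finset.card_insert_of_notMem, Finset.card_pair (hcd x hx)]
    · simp [(hcb x hx).symm, (hbd x hx).ne]
    · simp [(hac x hx).ne, hab x hx, had x hx]
  set m : V → ι → ℕ := fun v x => ((K x).filter fun u => u ≠ v ∧ ¬ G.Adj v u).card with hm
  have hm2 : ∀ x ∈ X, ∀ v ∈ K x, m v x ≤ 2 := by
    intro x hx v hv
    have aux : ∀ w ∈ K x, G.Adj v w → m v x ≤ 2 := by
      intro w hw hvw
      have hsub : (K x).filter (fun u => u ≠ v ∧ ¬ G.Adj v u) ⊆ ((K x).erase v).erase w := by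
        intro u hu
        obtain ⟨h1, h2, h3⟩ := Finset.mem_filter.1 hu
        exact Finset.mem_erase.2 ⟨fun h => h3 (h ▸ hvw), Finset.mem_erase.2 ⟨h2, h1⟩⟩
      have := Finset.card_le_card hsub
      rw [Finset.card_erase_of_mem (Finset.mem_erase.2 ⟨hvw.ne', hw⟩),
        Finset.card_erase_of_mem hv, hK4 x hx] at this
      exact this
    have hv' := hv
    simp only [hK, Finset.mem_insert, Finset.mem_singleton] at hv'
    rcases hv' with rfl | rfl | rfl | rfl
    · exact aux (c x) (by simp [hK]) (hac x hx)
    · exact aux (d x) (by simp [hK]) (hbd x hx)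
    · exact aux (a x) (by simp [hK]) (hac x hx).symm
    · exact aux (b x) (by simp [hK]) (hbd x hx).symm
  have hm0 : ∀ x ∈ X, G.Adj (a x) (b x) → ∀ v ∈ K x, m v x = 0 := by
    intro x hx hadj v hv
    rcases hcomp x hx with h | h
    · rw [hm]
      simp only [Finset.card_eq_zero, Finset.filter_eq_empty_iff]
      exact fun u hu h' => h'.2 (h v hv u hu h'.1.symm)
    · exact absurd hadj h
  set Xv : V → Finset ι := fun v => X.filter fun x => v ∈ K x with hXv
  have hlocal : ∀ v, 3 * (Xv v).card ≤ G.degree v + ∑ x ∈ Xv v, m v x := by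
    intro v
    have hdisj : (Xv v : Set ι).PairwiseDisjoint
        fun x => (K x).filter fun u => u ≠ v ∧ G.Adj v u := by
      intro x hx y hy hxy
      simp only [hXv, Finset.coe_filter, Set.mem_ofPred_eq] at hx hy
      refine Finset.disjoint_left.2 fun u hu hu' => ?_
      rw [Finset.mem_filter] at hu hu'
      have := Finset.card_le_one.1 (hnic x hx.1 y hy.1 hxy) u
        (Finset.mem_inter.2 ⟨hu.1, hu'.1⟩) v (Finset.mem_inter.2 ⟨hx.2, hy.2⟩)
      exact hu.2.1 this
    have h1 : ∑ x ∈ Xv v, ((K x).filter fun u => u ≠ v ∧ G.Adj v u).card ≤ G.degree v := by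
      rw [← Finset.card_biUnion hdisj, ← G.card_neighborFinset_eq_degree]
      refine Finset.card_le_card fun u hu => ?_
      obtain ⟨x, -, hu⟩ := Finset.mem_biUnion.1 hu
      simpa using (Finset.mem_filter.1 hu).2.2
    have h2 : ∀ x ∈ Xv v, 3 = ((K x).filter fun u => u ≠ v ∧ G.Adj v u).card + m v x := by
      intro x hx
      obtain ⟨hx, hv⟩ := Finset.mem_filter.1 hx
      have h3 : ((K x).erase v).card = 3 := by rw [Finset.card_erase_of_mem hv, hK4 x hx]
      rw [← h3, ← Finset.card_filter_add_card_filter_not (s := (K x).erase v) (G.Adj v)]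
      congr 2 <;> ext u <;> simp only [Finset.mem_filter, Finset.mem_erase] <;> tauto
    have h3 : ∑ x ∈ Xv v, 3 = _ := Finset.sum_congr rfl h2
    rw [Finset.sum_const, smul_eq_mul, Finset.sum_add_distrib] at h3
    omega
  have hvertex : ∀ v, 24 + 2 * (Xv v).card ≤ 4 * G.degree v + ∑ x ∈ Xv v, m v x := by
    intro v
    have := hlocal v
    have := hdeg v
    omega
  have hsum := Finset.sum_le_sum fun v (_ : v ∈ Finset.univ) => hvertex v
  have swap : ∀ f : V → ι → ℕ, ∑ v, ∑ x ∈ Xv v, f v x = ∑ x ∈ X, ∑ v ∈ K x, f v x := by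
    intro f
    refine Finset.sum_comm' fun v x => ?_
    simp [hXv, and_comm]
  have hs1 : ∑ v, (Xv v).card = 4 * X.card := by
    have := swap fun _ _ => 1
    simp only [Finset.sum_const, smul_eq_mul, mul_one] at this
    rw [this, Finset.sum_congr rfl hK4, Finset.sum_const, smul_eq_mul, mul_comm]
  have hs2 : ∑ v, ∑ x ∈ Xv v, m v x ≤ 8 * (X.filter fun x => ¬ G.Adj (a x) (b x)).card := by
    rw [swap, Finset.card_filter, Finset.mul_sum]
    refine Finset.sum_le_sum fun x hx => ?_
    by_cases h : G.Adj (a x) (b x)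
    · simp [Finset.sum_congr rfl (hm0 x hx h)]
    · have := Finset.sum_le_card_nsmul (K x) (fun v => m v x) 2 (hm2 x hx)
      rw [hK4 x hx] at this
      simpa [h] using this
  rw [Finset.sum_add_distrib, Finset.sum_add_distrib, ← Finset.mul_sum, ← Finset.mul_sum, hs1,
    G.sum_degrees_eq_twice_card_edges, Finset.sum_const, smul_eq_mul, Finset.card_univ] at hsum
  omega

namespace Drawing

variable {V : Type*} {G : SimpleGraph V} (D : Drawing G)

theorem mem_of_pos_mem_arcIm {e : G.edgeSet} {v : V} (h : D.pos v ∈ D.arcIm e) :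
    v ∈ (e : Sym2 V) :=
  by_contra fun hv => D.no_vertex_interior e v hv h

/-- The part of an arc between one of its ends and an interior point. -/
theorem exists_subarc {e : G.edgeSet} {u : V} (hu : u ∈ (e : Sym2 V)) {x : ℝ × ℝ}
    (hx : x ∈ D.arcIm e) (hxr : x ∉ Set.range D.pos) :
    ∃ T ⊆ D.arcIm e, JoinedIn T (D.pos u) x ∧ ∀ y, D.pos y ∈ T → y = u := by
  obtain ⟨t, ht, rfl⟩ := hx
  obtain ⟨p, q, he, h0, h1⟩ := D.arc_ends e
  have ht0 : t ≠ 0 := by rintro rfl; exact hxr ⟨p, h0.symm⟩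
  have ht1 : t ≠ 1 := by rintro rfl; exact hxr ⟨q, h1.symm⟩
  have hseg : ∀ r ∈ Icc (0 : ℝ) 1, JoinedIn (D.arc e '' uIcc r t) (D.arc e r) (D.arc e t) := by
    intro r hr
    have hsub : uIcc r t ⊆ Icc 0 1 := Set.uIcc_subset_Icc hr ht
    have hj : JoinedIn (uIcc r t) r t := by
      rw [← segment_eq_uIcc]
      exact (convex_segment r t).isPathConnected ⟨r, left_mem_segment ℝ r t⟩ |>.joinedIn _
        (left_mem_segment ℝ r t) _ (right_mem_segment ℝ r t)
    exact hj.map_continuousOn ((D.arc_cont e).mono hsub)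
  have hend : ∀ r ∈ Icc (0 : ℝ) 1, ∀ r' ∈ Icc (0 : ℝ) 1, ∀ z, D.arc e r' = D.pos z →
      r' ∉ uIcc r t → D.pos z ∉ D.arc e '' uIcc r t := by
    rintro r hr r' hr' z hz hn ⟨s, hs, hsz⟩
    exact hn (D.arc_inj e (Set.uIcc_subset_Icc hr ht hs) hr' (hsz.trans hz.symm) ▸ hs)
  have hsub : ∀ r ∈ Icc (0 : ℝ) 1, D.arc e '' uIcc r t ⊆ D.arcIm e := fun r hr =>
    image_mono (Set.uIcc_subset_Icc hr ht)
  have m0 : (0 : ℝ) ∈ Icc (0 : ℝ) 1 := by simp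
  have m1 : (1 : ℝ) ∈ Icc (0 : ℝ) 1 := by simp
  have hu' := hu
  rw [he, Sym2.mem_iff] at hu'
  rcases hu' with rfl | rfl
  · refine ⟨_, hsub 0 m0, h0 ▸ hseg 0 m0, fun y hy => ?_⟩
    have := D.mem_of_pos_mem_arcIm (hsub 0 m0 hy)
    rw [he, Sym2.mem_iff] at this
    rcases this with h | rfl
    · exact h
    · refine absurd hy (hend 0 m0 1 m1 _ h1 fun h => ?_)
      rw [uIcc_of_le ht.1] at h
      exact ht1 (le_antisymm ht.2 h.2)
  · refine ⟨_, hsub 1 m1, h1 ▸ hseg 1 m1, fun y hy => ?_⟩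
    have := D.mem_of_pos_mem_arcIm (hsub 1 m1 hy)
    rw [he, Sym2.mem_iff] at this
    rcases this with rfl | h
    · refine absurd hy (hend 1 m1 0 m0 _ h0 fun h => ?_)
      rw [uIcc_of_ge ht.2] at h
      exact ht0 (le_antisymm h.1 ht.1)
    · exact h

theorem eq_or_eq_of_mem_arcIm {x : ℝ × ℝ} (hx : x ∉ Set.range D.pos) {e₁ e₂ e : G.edgeSet}
    (hne : e₁ ≠ e₂) (h₁ : x ∈ D.arcIm e₁) (h₂ : x ∈ D.arcIm e₂) (h : x ∈ D.arcIm e) :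
    e = e₁ ∨ e = e₂ := by
  rcases D.at_most_two x hx e₁ e₂ e h₁ h₂ h with h | h | h
  · exact absurd h hne
  · exact Or.inl h.symm
  · exact Or.inr h.symm

/-- The edges crossing at `x` can be labelled `ac` and `bd` so that `a` and `b` are not adjacent,
unless the cluster of `x` is a clique. -/
theorem exists_labelling {x : ℝ × ℝ} (hx : x ∈ D.crossings) :
    ∃ (a b c d : V) (e f : G.edgeSet), (e : Sym2 V) = s(a, c) ∧ (f : Sym2 V) = s(b, d) ∧
      x ∈ D.arcIm e ∧ x ∈ D.arcIm f ∧ e ≠ f ∧ a ≠ b ∧ a ≠ d ∧ c ≠ b ∧ c ≠ d ∧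
      ((∀ u ∈ ({a, b, c, d} : Set V), ∀ w ∈ ({a, b, c, d} : Set V), u ≠ w → G.Adj u w) ∨
        ¬ G.Adj a b) := by
  obtain ⟨hxr, e, f, hne, he, hf⟩ := hx
  have hsep : ∀ v, v ∈ (e : Sym2 V) → v ∈ (f : Sym2 V) → False := fun v h h' =>
    hxr ⟨v, (D.shared_endpoint e f hne v h h' ⟨he, hf⟩).symm⟩
  obtain ⟨a, c, hac, -⟩ := D.arc_ends e
  obtain ⟨b, d, hbd, -⟩ := D.arc_ends f
  have hA : G.Adj a c := by have := e.2; rwa [hac] at this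
  have hB : G.Adj b d := by have := f.2; rwa [hbd] at this
  have hab : a ≠ b := by rintro rfl; exact hsep a (by simp [hac]) (by simp [hbd])
  have had : a ≠ d := by rintro rfl; exact hsep a (by simp [hac]) (by simp [hbd])
  have hcb : c ≠ b := by rintro rfl; exact hsep c (by simp [hac]) (by simp [hbd])
  have hcd : c ≠ d := by rintro rfl; exact hsep c (by simp [hac]) (by simp [hbd])
  by_cases h1 : G.Adj a b
  · by_cases h2 : G.Adj a d
    · by_cases h3 : G.Adj c b
      · by_cases h4 : G.Adj c d
        · refine ⟨a, b, c, d, e, f, hac, hbd, he, hf, hne, hab, had, hcb, hcd, Or.inl ?_⟩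
          rintro u (rfl | rfl | rfl | rfl) w (rfl | rfl | rfl | rfl) huw <;>
            first | exact absurd rfl huw | assumption | exact SimpleGraph.Adj.symm (by assumption)
        · exact ⟨c, d, a, b, e, f, hac.trans Sym2.eq_swap, hbd.trans Sym2.eq_swap, he, hf, hne,
            hcd, hcb, had, hab, Or.inr h4⟩
      · exact ⟨c, b, a, d, e, f, hac.trans Sym2.eq_swap, hbd, he, hf, hne,
            hcb, hcd, hab, had, Or.inr h3⟩
    · exact ⟨a, d, c, b, e, f, hac, hbd.trans Sym2.eq_swap, he, hf, hne,
            had, hab, hcd, hcb, Or.inr h2⟩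
  · exact ⟨a, b, c, d, e, f, hac, hbd, he, hf, hne, hab, had, hcb, hcd, Or.inr h1⟩

theorem IsOnePlanar.finite_crossings [Finite V] {D : Drawing G} (hD : D.IsOnePlanar) :
    D.crossings.Finite := by
  rcases D.crossings.eq_empty_or_nonempty with h | ⟨x₀, hx₀⟩
  · rw [h]
    exact Set.finite_empty
  have : Nonempty G.edgeSet := ⟨hx₀.2.choose⟩
  choose! e he using fun x (hx : x ∈ D.crossings) =>
    (show ∃ e, x ∈ D.arcIm e from ⟨_, hx.2.choose_spec.choose_spec.2.1⟩)
  refine Set.Finite.of_finite_image (f := e) (Set.toFinite _) fun x hx y hy hxy => ?_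
  exact hD (e x) ⟨hx, he x hx⟩ ⟨hy, hxy ▸ he y hy⟩

/-- In a 1-planar drawing, remove one of the two edges `ac`, `bd` at each crossing and add the
edge `ab` at some of them. The result is weakly planar. -/
theorem IsOnePlanar.weaklyPlanar {D : Drawing G} (hD : D.IsOnePlanar)
    {a b c d : ℝ × ℝ → V} {e f : ℝ × ℝ → G.edgeSet}
    (hac : ∀ x ∈ D.crossings, (e x : Sym2 V) = s(a x, c x))
    (hbd : ∀ x ∈ D.crossings, (f x : Sym2 V) = s(b x, d x))
    (he : ∀ x ∈ D.crossings, x ∈ D.arcIm (e x)) (hf : ∀ x ∈ D.crossings, x ∈ D.arcIm (f x))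
    (hef : ∀ x ∈ D.crossings, e x ≠ f x)
    {H : SimpleGraph V}
    (hH : ∀ u v, H.Adj u v → (∃ g : G.edgeSet, (g : Sym2 V) = s(u, v) ∧ ∀ x ∈ D.crossings, g ≠ f x)
      ∨ ∃ x ∈ D.crossings, s(a x, b x) = s(u, v)) : WeaklyPlanar H := by
  have key : ∀ u v, ∃ S, H.Adj u v → JoinedIn S (D.pos u) (D.pos v) ∧
      (∀ y, D.pos y ∈ S → y = u ∨ y = v) ∧
      ((∃ g : G.edgeSet, (g : Sym2 V) = s(u, v) ∧ S ⊆ D.arcIm g ∧ ∀ x ∈ D.crossings, g ≠ f x)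
      ∨ ∃ x ∈ D.crossings, s(a x, b x) = s(u, v) ∧ S ⊆ D.arcIm (e x) ∪ D.arcIm (f x)) := by
    intro u v
    by_cases huv : H.Adj u v
    · rcases hH u v huv with ⟨g, hg, hgf⟩ | ⟨x, hx, hxuv⟩
      · refine ⟨D.arcIm g, fun _ => ⟨?_, fun y hy => ?_, Or.inl ⟨g, hg, subset_rfl, hgf⟩⟩⟩
        · have hI : JoinedIn (Icc (0 : ℝ) 1) 0 1 :=
            ((convex_Icc 0 1).isPathConnected ⟨0, by simp⟩).joinedIn _ (by simp) _ (by simp)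
          have hj := hI.map_continuousOn (D.arc_cont g)
          obtain ⟨p, q, hpq, h0, h1⟩ := D.arc_ends g
          rw [h0, h1] at hj
          rcases Sym2.eq_iff.1 (hpq.symm.trans hg) with ⟨rfl, rfl⟩ | ⟨rfl, rfl⟩
          · exact hj
          · exact hj.symm
        · have := D.mem_of_pos_mem_arcIm hy
          rwa [hg, Sym2.mem_iff] at this
      · obtain ⟨T₁, hT₁, hj₁, hp₁⟩ := D.exists_subarc (u := a x) (by simp [hac x hx]) (he x hx) hx.1
        obtain ⟨T₂, hT₂, hj₂, hp₂⟩ := D.exists_subarc (u := b x) (by simp [hbd x hx]) (hf x hx) hx.1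
        have hj : JoinedIn (T₁ ∪ T₂) (D.pos (a x)) (D.pos (b x)) :=
          (hj₁.mono subset_union_left).trans (hj₂.mono subset_union_right).symm
        refine ⟨T₁ ∪ T₂, fun _ => ⟨?_, fun y hy => ?_, Or.inr ⟨x, hx, hxuv,
          union_subset_union hT₁ hT₂⟩⟩⟩
        · rcases Sym2.eq_iff.1 hxuv with ⟨rfl, rfl⟩ | ⟨rfl, rfl⟩
          · exact hj
          · exact hj.symm
        · rw [← Sym2.mem_iff, ← hxuv, Sym2.mem_iff]
          exact hy.imp (hp₁ y) (hp₂ y)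
    · exact ⟨∅, fun h => absurd h huv⟩
  choose S hS using key
  refine ⟨D.pos, S, fun u v h => (hS u v h).1, ?_⟩
  intro u v w z huv hwz huw huz hvw hvz
  obtain ⟨-, hp, ht⟩ := hS u v huv
  obtain ⟨-, hp', ht'⟩ := hS w z hwz
  have hne : ∀ y, y ∈ s(u, v) → y ∈ s(w, z) → False := by
    intro y hy hy'
    rw [Sym2.mem_iff] at hy hy'
    rcases hy with rfl | rfl <;> rcases hy' with h | h <;> contradiction
  have two : ∀ x ∈ D.crossings, ∀ g, x ∈ D.arcIm g → g = e x ∨ g = f x := fun x hx g hg =>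
    D.eq_or_eq_of_mem_arcIm hx.1 (hef x hx) (he x hx) (hf x hx) hg
  have mixed : ∀ (g : G.edgeSet), ∀ x ∈ D.crossings, ∀ q ∉ Set.range D.pos, q ∈ D.arcIm g →
      q ∈ D.arcIm (e x) ∪ D.arcIm (f x) → g ≠ f x → g = e x := by
    intro g x hx q hq hg hxq hgf
    by_contra hge
    obtain ⟨g', hg', hxg', hqg'⟩ : ∃ g', g ≠ g' ∧ x ∈ D.arcIm g' ∧ q ∈ D.arcIm g' :=
      hxq.elim (fun h => ⟨_, hge, he x hx, h⟩) fun h => ⟨_, hgf, hf x hx, h⟩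
    have := hD g' ⟨⟨hq, g, g', hg', hg, hqg'⟩, hqg'⟩ ⟨hx, hxg'⟩
    subst this
    exact (two q hx g hg).elim hge hgf
  refine Set.disjoint_left.2 fun q hq hq' => ?_
  by_cases hqr : q ∈ Set.range D.pos
  · obtain ⟨y, rfl⟩ := hqr
    exact hne y (Sym2.mem_iff.2 (hp y hq)) (Sym2.mem_iff.2 (hp' y hq'))
  rcases ht with ⟨g, hg, hSg, hgf⟩ | ⟨x, hx, hxuv, hSx⟩ <;>
    rcases ht' with ⟨g', hg', hSg', hgf'⟩ | ⟨x', hx', hxwz, hSx'⟩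
  · have hgg : g ≠ g' := by
      rintro rfl
      exact hne u (by simp) (by rw [← hg', hg]; simp)
    have hqc : q ∈ D.crossings := ⟨hqr, g, g', hgg, hSg hq, hSg' hq'⟩
    have h1 := (two q hqc g (hSg hq)).resolve_right (hgf q hqc)
    have h2 := (two q hqc g' (hSg' hq')).resolve_right (hgf' q hqc)
    exact hgg (h1.trans h2.symm)
  · have := mixed g x' hx' q hqr (hSg hq) (hSx' hq') (hgf x' hx')
    exact hne (a x') (by rw [← hg, this, hac x' hx']; simp) (by rw [← hxwz]; simp)
  · have := mixed g' x hx q hqr (hSg' hq') (hSx hq) (hgf' x hx)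
    exact hne (a x) (by rw [← hxuv]; simp) (by rw [← hg', this, hac x hx]; simp)
  · have hxx : x = x' := by
      obtain ⟨g, hg, hxg⟩ : ∃ g, q ∈ D.arcIm g ∧ x ∈ D.arcIm g :=
        (hSx hq).elim (fun h => ⟨_, h, he x hx⟩) fun h => ⟨_, h, hf x hx⟩
      have hxg' : x' ∈ D.arcIm g := by
        by_cases hgf : g = f x'
        · exact hgf ▸ hf x' hx'
        · exact mixed g x' hx' q hqr hg (hSx' hq') hgf ▸ he x' hx'
      exact hD g ⟨hx, hxg⟩ ⟨hx', hxg'⟩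
    subst hxx
    exact hne (a x) (by rw [← hxuv]; simp) (by rw [← hxwz]; simp)

end Drawing

/-- every NIC-planar graph with at least one vertex contains a
vertex of degree at most `6`. -/
theorem stmt3 {V : Type*} [Fintype V] [Nonempty V] (G : SimpleGraph V)
    (hG : G.NICPlanar) :
    ∃ v : V, (G.neighborSet v).ncard ≤ 6 := by
  classical
  by_contra! hcon
  have hdeg : ∀ v, 7 ≤ G.degree v := by
    intro v
    have := hcon v
    rwa [Set.ncard_eq_toFinset_card', Set.toFinset_card, G.card_neighborSet_eq_degree] at this
  obtain ⟨D, h1, h2⟩ := hG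
  obtain ⟨v₀⟩ := ‹Nonempty V›
  have hlab : ∀ x, ∃ (a b c d : V) (e f : G.edgeSet), x ∈ D.crossings →
      (e : Sym2 V) = s(a, c) ∧ (f : Sym2 V) = s(b, d) ∧
      x ∈ D.arcIm e ∧ x ∈ D.arcIm f ∧ e ≠ f ∧ a ≠ b ∧ a ≠ d ∧ c ≠ b ∧ c ≠ d ∧
      ((∀ u ∈ ({a, b, c, d} : Set V), ∀ w ∈ ({a, b, c, d} : Set V), u ≠ w → G.Adj u w) ∨
        ¬ G.Adj a b) := by
    intro x
    by_cases hx : x ∈ D.crossings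
    · obtain ⟨a, b, c, d, e, f, h⟩ := D.exists_labelling hx
      exact ⟨a, b, c, d, e, f, fun _ => h⟩
    · obtain ⟨w, hw⟩ := (G.degree_pos_iff_exists_adj v₀).1 (by have := hdeg v₀; omega)
      exact ⟨v₀, v₀, v₀, v₀, ⟨s(v₀, w), hw⟩, ⟨s(v₀, w), hw⟩, fun h => absurd h hx⟩
  choose a b c d e f hlab using hlab
  have hfin := h1.finite_crossings
  set X := hfin.toFinset with hX
  have hXm : ∀ x, x ∈ X ↔ x ∈ D.crossings := fun x => hfin.mem_toFinset
  have hcl : ∀ x ∈ X, ∀ v ∈ ({a x, b x, c x, d x} : Finset V), v ∈ D.cluster x := by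
    intro x hx v hv
    obtain ⟨he, hf, hxe, hxf, -⟩ := hlab x ((hXm x).1 hx)
    simp only [Finset.mem_insert, Finset.mem_singleton] at hv
    rcases hv with rfl | rfl | rfl | rfl
    · exact ⟨e x, hxe, by simp [he]⟩
    · exact ⟨f x, hxf, by simp [hf]⟩
    · exact ⟨e x, hxe, by simp [he]⟩
    · exact ⟨f x, hxf, by simp [hf]⟩
  have hnic : ∀ x ∈ X, ∀ y ∈ X, x ≠ y →
      (({a x, b x, c x, d x} : Finset V) ∩ {a y, b y, c y, d y}).card ≤ 1 := by
    intro x hx y hy hxy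
    refine le_trans ?_ (h2 x ((hXm x).1 hx) y ((hXm y).1 hy) hxy)
    rw [← Set.ncard_coe_finset]
    refine Set.ncard_le_ncard (fun v hv => ?_) (Set.toFinite _)
    rw [Finset.mem_coe, Finset.mem_inter] at hv
    exact ⟨hcl x hx v hv.1, hcl y hy v hv.2⟩
  have hadj : ∀ x ∈ X, G.Adj (a x) (c x) ∧ G.Adj (b x) (d x) := by
    intro x hx
    obtain ⟨he, hf, -⟩ := hlab x ((hXm x).1 hx)
    exact ⟨by have := (e x).2; rwa [he] at this, by have := (f x).2; rwa [hf] at this⟩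
  have hcount := three_mul_card_add_card_le G X a b c d (fun x hx => (hadj x hx).1)
    (fun x hx => (hadj x hx).2)
    (fun x hx => (hlab x ((hXm x).1 hx)).2.2.2.2.2.1)
    (fun x hx => (hlab x ((hXm x).1 hx)).2.2.2.2.2.2.1)
    (fun x hx => (hlab x ((hXm x).1 hx)).2.2.2.2.2.2.2.1)
    (fun x hx => (hlab x ((hXm x).1 hx)).2.2.2.2.2.2.2.2.1) hnic
    (fun x hx => by simpa using (hlab x ((hXm x).1 hx)).2.2.2.2.2.2.2.2.2)
    hdeg
  set Y := X.filter fun x => ¬ G.Adj (a x) (b x) with hY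
  set R := X.image fun x => (f x : Sym2 V) with hR
  set N := Y.image fun x => s(a x, b x) with hN
  have hNc : N.card = Y.card := by
    refine Finset.card_image_of_injOn fun x hx y hy hxy => by_contra fun hne => ?_
    replace hx := (Finset.mem_filter.1 hx).1
    replace hy := (Finset.mem_filter.1 hy).1
    have hmem : ∀ v, v ∈ s(a x, b x) →
        v ∈ ({a x, b x, c x, d x} : Finset V) ∩ {a y, b y, c y, d y} := by
      intro v hv
      have hv' : v ∈ s(a y, b y) := hxy ▸ hv
      rw [Sym2.mem_iff] at hv hv'
      simp only [Finset.mem_inter, Finset.mem_insert, Finset.mem_singleton]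
      tauto
    exact (hlab x ((hXm x).1 hx)).2.2.2.2.2.1 (Finset.card_le_one.1 (hnic x hx y hy hne)
      _ (hmem _ (by simp)) _ (hmem _ (by simp)))
  have hdisj : Disjoint (G.edgeFinset \ R) N := by
    refine Finset.disjoint_left.2 fun q hq hq' => ?_
    obtain ⟨x, hx, rfl⟩ := Finset.mem_image.1 hq'
    exact (Finset.mem_filter.1 hx).2 (SimpleGraph.mem_edgeFinset.1 (Finset.mem_sdiff.1 hq).1)
  set T := (G.edgeFinset \ R) ∪ N with hT
  have hTc : G.edgeFinset.card + Y.card ≤ T.card + X.card := by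
    rw [hT, Finset.card_union_of_disjoint hdisj, hNc]
    have h3 := Finset.le_card_sdiff R G.edgeFinset
    have h4 : R.card ≤ X.card := Finset.card_image_le
    omega
  have hweak : WeaklyPlanar (SimpleGraph.fromEdgeSet (T : Set (Sym2 V))) := by
    refine h1.weaklyPlanar (a := a) (b := b) (c := c) (d := d) (e := e) (f := f)
      (fun x hx => (hlab x hx).1) (fun x hx => (hlab x hx).2.1)
      (fun x hx => (hlab x hx).2.2.1) (fun x hx => (hlab x hx).2.2.2.1)
      (fun x hx => (hlab x hx).2.2.2.2.1) fun u v huv => ?_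
    rw [SimpleGraph.fromEdgeSet_adj, Finset.mem_coe, hT, Finset.mem_union] at huv
    rcases huv.1 with h | h
    · obtain ⟨h, h'⟩ := Finset.mem_sdiff.1 h
      refine Or.inl ⟨⟨s(u, v), SimpleGraph.mem_edgeFinset.1 h⟩, rfl, fun x hx hxf => h' ?_⟩
      exact Finset.mem_image.2 ⟨x, (hXm x).2 hx, by rw [← hxf]⟩
    · obtain ⟨x, hx, hxuv⟩ := Finset.mem_image.1 h
      exact Or.inr ⟨x, (hXm x).1 (Finset.mem_filter.1 hx).1, hxuv⟩
  have hlt := hweak.card_edgeFinset_add_one_lt (U := Finset.univ) ⟨v₀, Finset.mem_univ _⟩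
    fun u _ _ => Finset.mem_univ u
  rw [Finset.card_univ] at hlt
  have : T.card + 1 < 3 * Fintype.card V := by
    refine lt_of_le_of_lt (Nat.add_le_add_right (Finset.card_le_card fun q hq => ?_) 1) hlt
    refine (@Set.mem_toFinset _ _ (_) _).2 ?_
    rw [SimpleGraph.edgeSet_fromEdgeSet]
    refine ⟨hq, ?_⟩
    rcases Finset.mem_union.1 hq with h | h
    · exact G.not_isDiag_of_mem_edgeSet (SimpleGraph.mem_edgeFinset.1 (Finset.mem_sdiff.1 h).1)
    · obtain ⟨x, hx, rfl⟩ := Finset.mem_image.1 h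
      simpa using (hlab x ((hXm x).1 (Finset.mem_filter.1 hx).1)).2.2.2.2.2.1
  omega
end
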